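/- Let n ≥ 2 and β ∈ (0,∞). On the generalised Heisenberg group, set ξ(x) = log(1/|x|) (for x ≠ 0) and U(x,z) = V(βN(x,z) + ξ(x)), where V: ℝ → ℝ is twice differentiable and nondecreasing with V'(s)/s² → ∞ as s → ∞ and ¼V'(s)² − ½V''(s) ≥ 0 for all s outside a compact set. Assume 0 < Z := ∫ e^{−U} dλ < ∞. Then the probability measure dμ_U = Z⁻¹ e^{−U} dλ satisfies the Poincaré inequality: there exists c ∈ (0,∞) with μ_U((f − μ_U(f))²) ≤ c μ_U(|∇f|²) for every smooth compactly supported f. -/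

import Mathlib

open Real MeasureTheory Filter

/-- A point of the generalised Heisenberg group `ℝ^{2n+1}`. -/
abbrev PtG (n : ℕ) := (Fin (2 * n) → ℝ) × ℝ

/-- The horizontal vector fields of the generalised Heisenberg group with parameters `L`:
`X_j = ∂/∂x_j − L_j x_{j+n} ∂/∂z` for `j < n` and
`X_j = ∂/∂x_j + L_{j−n} x_{j−n} ∂/∂z` for `n ≤ j < 2n`. -/
noncomputable def XG {n : ℕ} (L : Fin n → ℝ) (j : Fin (2 * n))
    (f : PtG n → ℝ) (p : PtG n) : ℝ :=
  fderiv ℝ f p (Pi.single j 1, 0) +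
    (if h : (j : ℕ) < n then
        -(L ⟨j, h⟩) * p.1 ⟨(j : ℕ) + n, by omega⟩
      else
        L ⟨(j : ℕ) - n, by have := j.isLt; omega⟩ *
          p.1 ⟨(j : ℕ) - n, by have := j.isLt; omega⟩) *
      fderiv ℝ f p (0, 1)

/-- The squared length of the sub-gradient, `|∇f|² = Σ_j (X_j f)²`. -/
noncomputable def gradSqG {n : ℕ} (L : Fin n → ℝ) (f : PtG n → ℝ) (p : PtG n) : ℝ :=
  ∑ j : Fin (2 * n), (XG L j f p) ^ 2

/-- The sum `Σ_{k<n} |L_k| (x_k² + x_{k+n}²)`. -/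
noncomputable def SG {n : ℕ} (L : Fin n → ℝ) (x : Fin (2 * n) → ℝ) : ℝ :=
  ∑ k : Fin n, |L k| *
    (x ⟨(k : ℕ), by have := k.isLt; omega⟩ ^ 2 +
     x ⟨(k : ℕ) + n, by have := k.isLt; omega⟩ ^ 2)

/-- The Kaplan norm `N(x,z) = ((Σ_k 2|L_k|(x_k² + x_{k+n}²))² + 16 z²)^(1/4)`
of the generalised Heisenberg group. -/
noncomputable def NG {n : ℕ} (L : Fin n → ℝ) (p : PtG n) : ℝ :=
  ((2 * SG L p.1) ^ 2 + 16 * p.2 ^ 2) ^ ((1 : ℝ) / 4)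

/-- Euclidean length of the horizontal component `x` of a point. -/
noncomputable def xnormG {n : ℕ} (p : PtG n) : ℝ :=
  Real.sqrt (∑ j, p.1 j ^ 2)

/-- The normalized Gibbs measure `Z⁻¹ e^{−U} dλ`. -/
noncomputable def gibbsP {E : Type*} [MeasureSpace E] (U : E → ℝ) : Measure E :=
  (ENNReal.ofReal (∫ p, Real.exp (-(U p))))⁻¹ •
    (volume.withDensity fun p => ENNReal.ofReal (Real.exp (-(U p))))

/-- The energy `U(x,z) = V(β N(x,z) + log(1/|x|))` on the generalised Heisenberg group. -/
noncomputable def Ulog {n : ℕ} (L : Fin n → ℝ) (β : ℝ) (V : ℝ → ℝ) (p : PtG n) : ℝ :=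
  V (β * NG L p + Real.log (1 / xnormG p))

/-- The coefficient vector `Y(x)` with `X_j = ∂_j + Y_j ∂_z`. -/
noncomputable def Yv {n : ℕ} (L : Fin n → ℝ) (x : Fin (2 * n) → ℝ) (j : Fin (2 * n)) : ℝ :=
  if h : (j : ℕ) < n then
        -(L ⟨j, h⟩) * x ⟨(j : ℕ) + n, by omega⟩
      else
        L ⟨(j : ℕ) - n, by have := j.isLt; omega⟩ *
          x ⟨(j : ℕ) - n, by have := j.isLt; omega⟩

lemma XG_eq {n : ℕ} (L : Fin n → ℝ) (j : Fin (2 * n)) (f : PtG n → ℝ) (p : PtG n) :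
    XG L j f p = fderiv ℝ f p (Pi.single j 1, 0) + Yv L p.1 j * fderiv ℝ f p (0, 1) := rfl

lemma sum_split {n : ℕ} (φ : Fin (2 * n) → ℝ) :
    ∑ j, φ j = ∑ k : Fin n, (φ ⟨(k : ℕ), by have := k.isLt; omega⟩ +
      φ ⟨(k : ℕ) + n, by have := k.isLt; omega⟩) := by
  have h : n + n = 2 * n := by ring
  rw [← Equiv.sum_comp (finCongr h) φ, Fin.sum_univ_add, ← Finset.sum_add_distrib]
  refine Finset.sum_congr rfl fun k _ => ?_
  congr 1
  congr 1
  ext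
  simp [add_comm]

lemma Yv_lo {n : ℕ} (L : Fin n → ℝ) (x : Fin (2 * n) → ℝ) (k : Fin n) (h) :
    Yv L x ⟨(k : ℕ), h⟩ = -(L k) * x ⟨(k : ℕ) + n, by omega⟩ := by
  simp [Yv]

lemma Yv_hi {n : ℕ} (L : Fin n → ℝ) (x : Fin (2 * n) → ℝ) (k : Fin n) (h) :
    Yv L x ⟨(k : ℕ) + n, h⟩ = L k * x ⟨(k : ℕ), by omega⟩ := by
  simp [Yv]

/-- `|Y(x)|²`. -/
noncomputable def PG {n : ℕ} (L : Fin n → ℝ) (x : Fin (2 * n) → ℝ) : ℝ := ∑ j, Yv L x j ^ 2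

/-- `|x|²`. -/
noncomputable def qG {n : ℕ} (x : Fin (2 * n) → ℝ) : ℝ := ∑ j, x j ^ 2

/-- The symplectic form. -/
noncomputable def om {n : ℕ} (L : Fin n → ℝ) (v x : Fin (2 * n) → ℝ) : ℝ := ∑ j, v j * Yv L x j

lemma Yv_add {n : ℕ} (L : Fin n → ℝ) (x y : Fin (2 * n) → ℝ) (j) :
    Yv L (x + y) j = Yv L x j + Yv L y j := by
  unfold Yv; split_ifs <;> simp <;> ring

lemma Yv_smul {n : ℕ} (L : Fin n → ℝ) (t : ℝ) (x : Fin (2 * n) → ℝ) (j) :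
    Yv L (t • x) j = t * Yv L x j := by
  unfold Yv; split_ifs <;> simp <;> ring

lemma om_self {n : ℕ} (L : Fin n → ℝ) (x : Fin (2 * n) → ℝ) : om L x x = 0 := by
  unfold om
  rw [sum_split]
  refine Finset.sum_eq_zero fun k _ => ?_
  rw [Yv_lo, Yv_hi]; ring

lemma om_add_right {n : ℕ} (L : Fin n → ℝ) (v x y : Fin (2 * n) → ℝ) :
    om L v (x + y) = om L v x + om L v y := by
  simp [om, Yv_add, mul_add, Finset.sum_add_distrib]

lemma om_smul_right {n : ℕ} (L : Fin n → ℝ) (v x : Fin (2 * n) → ℝ) (t : ℝ) :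
    om L v (t • x) = t * om L v x := by
  simp only [om, Yv_smul, Finset.mul_sum]
  exact Finset.sum_congr rfl fun _ _ => by ring

lemma om_smul_left {n : ℕ} (L : Fin n → ℝ) (v x : Fin (2 * n) → ℝ) (t : ℝ) :
    om L (t • v) x = t * om L v x := by
  simp only [om, Finset.mul_sum, Pi.smul_apply, smul_eq_mul]
  exact Finset.sum_congr rfl fun _ _ => by ring

lemma continuous_Yv {n : ℕ} (L : Fin n → ℝ) (j) : Continuous fun x => Yv L x j := by
  unfold Yv; split_ifs <;> fun_prop

lemma contDiff_Yv {n : ℕ} (L : Fin n → ℝ) (j) {m} : ContDiff ℝ m fun x => Yv L x j := by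
  unfold Yv; split_ifs <;> fun_prop

lemma contDiff_SG {n : ℕ} (L : Fin n → ℝ) {m} : ContDiff ℝ m (SG L) := by
  unfold SG; fun_prop

lemma contDiff_PG {n : ℕ} (L : Fin n → ℝ) {m} : ContDiff ℝ m (PG L) := by
  unfold PG
  exact ContDiff.sum fun j _ => (contDiff_Yv L j).pow 2

lemma contDiff_qG {n : ℕ} {m} : ContDiff ℝ m (qG (n := n)) := by
  unfold qG; fun_prop

lemma SG_radial {n : ℕ} (L : Fin n → ℝ) (t : ℝ) (x : Fin (2 * n) → ℝ) :
    SG L (x + t • x) = (1 + t) ^ 2 * SG L x := by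
  simp only [SG, Finset.mul_sum, Pi.add_apply, Pi.smul_apply, smul_eq_mul]
  exact Finset.sum_congr rfl fun _ _ => by ring

lemma SG_rot {n : ℕ} (L : Fin n → ℝ) (t : ℝ) (x : Fin (2 * n) → ℝ) :
    SG L (x + t • Yv L x) = SG L x + t ^ 2 * SG L (Yv L x) := by
  simp only [SG, Finset.mul_sum, Pi.add_apply, Pi.smul_apply, smul_eq_mul,
    ← Finset.sum_add_distrib]
  refine Finset.sum_congr rfl fun k _ => ?_
  rw [Yv_lo, Yv_hi]; ring

lemma qG_radial {n : ℕ} (t : ℝ) (x : Fin (2 * n) → ℝ) :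
    qG (x + t • x) = (1 + t) ^ 2 * qG x := by
  simp only [qG, Finset.mul_sum, Pi.add_apply, Pi.smul_apply, smul_eq_mul]
  exact Finset.sum_congr rfl fun _ _ => by ring

lemma qG_rot {n : ℕ} (L : Fin n → ℝ) (t : ℝ) (x : Fin (2 * n) → ℝ) :
    qG (x + t • Yv L x) = qG x + t ^ 2 * qG (Yv L x) := by
  have h := om_self L x
  unfold om at h
  have : qG (x + t • Yv L x) = qG x + t ^ 2 * qG (Yv L x) + 2 * t * ∑ j, x j * Yv L x j := by
    simp only [qG, Finset.mul_sum, Pi.add_apply, Pi.smul_apply, smul_eq_mul,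
      ← Finset.sum_add_distrib]
    exact Finset.sum_congr rfl fun _ _ => by ring
  rw [this, h]; ring

lemma SG_nonneg {n : ℕ} (L : Fin n → ℝ) (x : Fin (2 * n) → ℝ) : 0 ≤ SG L x := by
  unfold SG; positivity

lemma qG_nonneg {n : ℕ} (x : Fin (2 * n) → ℝ) : 0 ≤ qG x := by
  unfold qG; positivity

lemma PG_eq {n : ℕ} (L : Fin n → ℝ) (x : Fin (2 * n) → ℝ) :
    PG L x = ∑ k : Fin n, |L k| * (|L k| *
    (x ⟨(k : ℕ), by have := k.isLt; omega⟩ ^ 2 +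
     x ⟨(k : ℕ) + n, by have := k.isLt; omega⟩ ^ 2)) := by
  unfold PG
  rw [sum_split]
  refine Finset.sum_congr rfl fun k _ => ?_
  rw [Yv_lo, Yv_hi, ← mul_assoc, abs_mul_abs_self]; ring

lemma exists_consts {n : ℕ} (hn : 2 ≤ n) (L : Fin n → ℝ) (hL : ∀ j, L j ≠ 0) :
    ∃ l l' : ℝ, 0 < l ∧ 0 < l' ∧ ∀ x, l * (2 * SG L x) ≤ PG L x ∧ PG L x ≤ l' * (2 * SG L x) ∧
      l * qG x ≤ 2 * SG L x := by
  have : Nonempty (Fin n) := ⟨⟨0, by omega⟩⟩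
  obtain ⟨k0, h0⟩ := Finite.exists_min fun k => |L k|
  obtain ⟨k1, h1⟩ := Finite.exists_max fun k => |L k|
  have p0 : 0 < |L k0| := abs_pos.2 (hL _)
  have p1 : 0 < |L k1| := abs_pos.2 (hL _)
  refine ⟨|L k0| / 2, |L k1| / 2, by positivity, by positivity, fun x => ?_⟩
  rw [PG_eq, qG, sum_split]
  unfold SG
  refine ⟨?_, ?_, ?_⟩
  · have : ∀ a b : ℝ, a / 2 * (2 * b) = a * b := by intros; ring
    rw [this, Finset.mul_sum]
    exact Finset.sum_le_sum fun k _ => mul_le_mul_of_nonneg_right (h0 k) (by positivity)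
  · have : ∀ a b : ℝ, a / 2 * (2 * b) = a * b := by intros; ring
    rw [this, Finset.mul_sum]
    exact Finset.sum_le_sum fun k _ => mul_le_mul_of_nonneg_right (h1 k) (by positivity)
  · rw [Finset.mul_sum, Finset.mul_sum]
    refine Finset.sum_le_sum fun k _ => ?_
    have := h0 k
    have hh : |L k0| / 2 ≤ 2 * |L k| := by linarith
    rw [← mul_assoc]
    exact mul_le_mul_of_nonneg_right hh (by positivity)

lemma qG_pos {n : ℕ} {x : Fin (2 * n) → ℝ} (hx : x ≠ 0) : 0 < qG x := by
  obtain ⟨j, hj⟩ := Function.ne_iff.1 hx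
  have h1 : x j ^ 2 ≤ qG x := Finset.single_le_sum (f := fun j => x j ^ 2)
    (fun i _ => sq_nonneg (x i)) (Finset.mem_univ j)
  have : 0 < x j ^ 2 := by have : x j ≠ 0 := hj
                           positivity
  linarith

lemma abs_coord_le {n : ℕ} (x : Fin (2 * n) → ℝ) (j) : |x j| ≤ √(qG x) := by
  apply Real.abs_le_sqrt
  exact Finset.single_le_sum (f := fun j => x j ^ 2)
    (fun i _ => sq_nonneg (x i)) (Finset.mem_univ j)

/-- gradient in a horizontal direction -/
lemma fderiv_horizontal {n : ℕ} (L : Fin n → ℝ) (f : PtG n → ℝ) (p : PtG n)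
    (v : Fin (2 * n) → ℝ) :
    fderiv ℝ f p (v, om L v p.1) = ∑ j, v j * XG L j f p := by
  have h1 : ((v, om L v p.1) : PtG n) =
      ∑ j, v j • ((Pi.single j 1, 0) : PtG n) + om L v p.1 • ((0, 1) : PtG n) := by
    ext i
    · simp [Finset.sum_apply, Pi.single_apply, Prod.fst_sum]
    · simp [Prod.snd_sum]
  rw [h1, map_add, map_sum]
  simp only [map_smul, XG_eq, smul_eq_mul, mul_add, Finset.sum_add_distrib, om, Finset.sum_mul]
  congr 1
  exact Finset.sum_congr rfl fun _ _ => by ring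

lemma horizontal_sq_le {n : ℕ} (L : Fin n → ℝ) (f : PtG n → ℝ) (p : PtG n)
    (v : Fin (2 * n) → ℝ) :
    (fderiv ℝ f p (v, om L v p.1)) ^ 2 ≤ qG v * gradSqG L f p := by
  rw [fderiv_horizontal]
  exact Finset.sum_mul_sq_le_sq_mul_sq _ _ _

/-- integration by parts -/
lemma ibp {n : ℕ} {F c : PtG n → ℝ} (hF : ContDiff ℝ 1 F) (hs : HasCompactSupport F)
    (hc : ContDiff ℝ 1 c) (v : PtG n) :
    ∫ p, c p * fderiv ℝ F p v = - ∫ p, fderiv ℝ c p v * F p := by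
  have hs' : HasCompactSupport fun p => fderiv ℝ F p v := hs.fderiv_apply (𝕜 := ℝ) v
  have c1 : Continuous fun p => fderiv ℝ F p v := (hF.continuous_fderiv one_ne_zero).clm_apply
    continuous_const
  have c2 : Continuous fun p => fderiv ℝ c p v := (hc.continuous_fderiv one_ne_zero).clm_apply
    continuous_const
  have : (volume : Measure (PtG n)).IsAddHaarMeasure := by
    rw [Measure.volume_eq_prod]; infer_instance
  apply integral_mul_fderiv_eq_neg_fderiv_mul_of_integrable
  · exact (c2.mul hF.continuous).integrable_of_hasCompactSupport hs.mul_left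
  · exact (hc.continuous.mul c1).integrable_of_hasCompactSupport hs'.mul_left
  · exact (hc.continuous.mul hF.continuous).integrable_of_hasCompactSupport hs.mul_left
  · exact fun x _ => hc.differentiable one_ne_zero x
  · exact fun x _ => hF.differentiable one_ne_zero x

lemma ibp_int {n : ℕ} {F c : PtG n → ℝ} (hF : ContDiff ℝ 1 F) (hs : HasCompactSupport F)
    (hc : Continuous c) (v : PtG n) :
    Integrable fun p => c p * fderiv ℝ F p v := by
  have hs' : HasCompactSupport fun p => fderiv ℝ F p v := hs.fderiv_apply (𝕜 := ℝ) v
  have c1 : Continuous fun p => fderiv ℝ F p v := (hF.continuous_fderiv one_ne_zero).clm_apply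
    continuous_const
  exact (hc.mul c1).integrable_of_hasCompactSupport hs'.mul_left

lemma vec_decomp {n : ℕ} (F : PtG n → ℝ) (p : PtG n) (v : Fin (2 * n) → ℝ) (w : ℝ) :
    fderiv ℝ F p (v, w) = ∑ j, v j * fderiv ℝ F p (Pi.single j 1, 0) + w * fderiv ℝ F p (0, 1) := by
  have h1 : ((v, w) : PtG n) =
      ∑ j, v j • ((Pi.single j 1, 0) : PtG n) + w • ((0, 1) : PtG n) := by
    ext i
    · simp [Finset.sum_apply, Pi.single_apply, Prod.fst_sum]
    · simp [Prod.snd_sum]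
  rw [h1, map_add, map_sum]
  simp only [map_smul, smul_eq_mul]

lemma ibp_R {n : ℕ} {F : PtG n → ℝ} (hF : ContDiff ℝ 1 F) (hs : HasCompactSupport F) :
    Integrable (fun p : PtG n => fderiv ℝ F p (p.1, 0)) ∧
    ∫ p : PtG n, fderiv ℝ F p (p.1, 0) = - (2 * n) * ∫ p, F p := by
  have e : ∀ p : PtG n, fderiv ℝ F p (p.1, 0) =
    ∑ j, p.1 j * fderiv ℝ F p (Pi.single j 1, 0) := fun p => by
      rw [vec_decomp]; simp
  simp only [e]
  have hi : ∀ j, Integrable fun p : PtG n => p.1 j * fderiv ℝ F p (Pi.single j 1, 0) :=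
    fun j => ibp_int hF hs (by fun_prop) _
  refine ⟨integrable_finsetSum _ fun j _ => hi j, ?_⟩
  rw [integral_finsetSum _ fun j _ => hi j]
  have : ∀ j, ∫ p : PtG n, p.1 j * fderiv ℝ F p (Pi.single j 1, 0) = - ∫ p, F p := by
    intro j
    rw [ibp (c := fun p : PtG n => p.1 j) hF hs (by fun_prop)]
    congr 2
    ext p
    have : HasFDerivAt (fun p : PtG n => p.1 j)
      ((ContinuousLinearMap.proj (R := ℝ) j).comp (ContinuousLinearMap.fst ℝ _ ℝ)) p :=
      ((ContinuousLinearMap.proj (R := ℝ) (φ := fun _ : Fin (2 * n) => ℝ) j).comp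
        (ContinuousLinearMap.fst ℝ (Fin (2 * n) → ℝ) ℝ)).hasFDerivAt
    rw [this.fderiv]; simp
  simp [this]

lemma ibp_T {n : ℕ} (L : Fin n → ℝ) {F : PtG n → ℝ} (hF : ContDiff ℝ 1 F)
    (hs : HasCompactSupport F) :
    Integrable (fun p : PtG n => fderiv ℝ F p (Yv L p.1, PG L p.1)) ∧
    ∫ p : PtG n, fderiv ℝ F p (Yv L p.1, PG L p.1) = 0 := by
  have e : ∀ p : PtG n, fderiv ℝ F p (Yv L p.1, PG L p.1) =
    ∑ j, Yv L p.1 j * fderiv ℝ F p (Pi.single j 1, 0) + PG L p.1 * fderiv ℝ F p (0, 1) :=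
    fun p => vec_decomp _ _ _ _
  simp only [e]
  have hY : ∀ j, ContDiff ℝ 1 fun p : PtG n => Yv L p.1 j :=
    fun j => (contDiff_Yv L j).comp contDiff_fst
  have hP : ContDiff ℝ 1 fun p : PtG n => PG L p.1 := (contDiff_PG L).comp contDiff_fst
  have hi : ∀ j, Integrable fun p : PtG n => Yv L p.1 j * fderiv ℝ F p (Pi.single j 1, 0) :=
    fun j => ibp_int hF hs (hY j).continuous _
  have hi2 : Integrable fun p : PtG n => PG L p.1 * fderiv ℝ F p (0, 1) :=
    ibp_int hF hs hP.continuous _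
  refine ⟨(integrable_finsetSum _ fun j _ => hi j).add hi2, ?_⟩
  rw [integral_add (integrable_finsetSum _ fun j _ => hi j) hi2,
    integral_finsetSum _ fun j _ => hi j]
  have line0 : ∀ (c : PtG n → ℝ) (p v : PtG n), DifferentiableAt ℝ c p →
      (∀ t : ℝ, c (p + t • v) = c p) → fderiv ℝ c p v = 0 := by
    intro c p v hd h
    have := hd.hasFDerivAt.hasLineDerivAt v
    unfold HasLineDerivAt at this
    simp only [h] at this
    exact this.unique (hasDerivAt_const _ _)
  have h1 : ∀ j, ∫ p : PtG n, Yv L p.1 j * fderiv ℝ F p (Pi.single j 1, 0) = 0 := by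
    intro j
    rw [ibp (c := fun p : PtG n => Yv L p.1 j) hF hs (hY j)]
    simp only [neg_eq_zero]
    apply integral_eq_zero_of_ae
    refine Eventually.of_forall fun p => ?_
    have : fderiv ℝ (fun p : PtG n => Yv L p.1 j) p (Pi.single j 1, 0) = 0 := by
      refine line0 _ _ _ ((hY j).differentiable one_ne_zero p) fun t => ?_
      simp only [Prod.fst_add, Prod.smul_fst, Yv_add, Yv_smul]
      have : Yv L (Pi.single j 1) j = 0 := by
        unfold Yv
        split_ifs with h
        · rw [Pi.single_eq_of_ne]
          · simp
          · intro h; rw [Fin.ext_iff] at h; simp at h; omega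
        · rw [Pi.single_eq_of_ne]
          · simp
          · intro h; rw [Fin.ext_iff] at h; simp at h; omega
      rw [this]; simp
    simp [this]
  have h2 : ∫ p : PtG n, PG L p.1 * fderiv ℝ F p (0, 1) = 0 := by
    rw [ibp (c := fun p : PtG n => PG L p.1) hF hs hP]
    simp only [neg_eq_zero]
    apply integral_eq_zero_of_ae
    refine Eventually.of_forall fun p => ?_
    have : fderiv ℝ (fun p : PtG n => PG L p.1) p (0, 1) = 0 :=
      line0 _ _ _ (hP.differentiable one_ne_zero p) fun t => by simp
    simp [this]
  simp [h1, h2]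

/-- coefficient of the radial field -/
noncomputable def aF (ε A m : ℝ) : ℝ := ε * (A * m) - 1 / (1 + A)
/-- coefficient of the rotational field -/
noncomputable def bF (ε k z m : ℝ) : ℝ := ε * k * (z * m)
/-- the derivative of the argument of the potential along the field -/
noncomputable def EF (ε k β A z N m P : ℝ) : ℝ :=
  aF ε A m * (β * (A ^ 2 / N ^ 3) - 1) + bF ε k z m * (β * (8 * z * P / N ^ 3))
/-- radial derivative of `aF` -/
noncomputable def RaF (ε A m : ℝ) : ℝ :=
  ε * (2 * A * m + A * (- 2 * A ^ 2 * m ^ 3)) + 2 * A / (1 + A) ^ 2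
/-- rotational derivative of `bF` -/
noncomputable def TbF (ε k z m P : ℝ) : ℝ := ε * k * (P * m + z * (- 16 * z * P * m ^ 3))
/-- divergence plus square of the field -/
noncomputable def GF (d ε k A z m P q : ℝ) : ℝ :=
  RaF ε A m + d * aF ε A m + TbF ε k z m P + (aF ε A m ^ 2 * q + bF ε k z m ^ 2 * P)

set_option maxHeartbeats 2000000 in
lemma lyap (d β l l' : ℝ) (hd : 4 ≤ d) (hβ : 0 < β) (hl : 0 < l) (hl' : 0 < l') :
    ∃ ε k A₀ Q N₁ : ℝ, 0 < ε ∧ 0 < k ∧ 0 < A₀ ∧ 0 < Q ∧ 1 ≤ N₁ ∧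
      ∀ A z N m P q : ℝ, 0 < A → 0 < N → 0 < m → N ^ 4 = A ^ 2 + 16 * z ^ 2 →
        m ^ 2 * (1 + N ^ 4) = 1 → l * A ≤ P → P ≤ l' * A → 0 ≤ q → l * q ≤ A →
        (∀ vp, 0 ≤ vp → A ≤ A₀ → 1 / 2 ≤ vp * EF ε k β A z N m P - GF d ε k A z m P q) ∧
        (∀ vp, A₀ ≤ A → N₁ ≤ N → Q * N ≤ vp →
          1 / 2 ≤ vp * EF ε k β A z N m P - GF d ε k A z m P q) ∧
        (A ≤ A₀ → aF ε A m ≤ 0) ∧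
        - (4 * A) ≤ aF ε A m * (4 * A ^ 2) + bF ε k z m * (32 * z * P) := by
  obtain ⟨k, hk⟩ : ∃ k, k = 2 / l := ⟨_, rfl⟩
  have hk0 : 0 < k := by rw [hk]; positivity
  have hkl : k * l = 2 := by rw [hk]; field_simp
  obtain ⟨C1, hC1⟩ : ∃ C1, C1 = 2 + d + k * l' := ⟨_, rfl⟩
  obtain ⟨C3, hC3⟩ : ∃ C3, C3 = 1 / l + k ^ 2 * l' := ⟨_, rfl⟩
  have hC1p : 0 < C1 := by rw [hC1]; positivity
  have hC3p : 0 < C3 := by rw [hC3]; positivity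
  obtain ⟨ε, hε0, hε1, hε2⟩ : ∃ ε : ℝ, 0 < ε ∧ ε ≤ 1 / 8 ∧ ε * C1 ≤ 1 / 4 := by
    refine ⟨min (1 / 8) (1 / (4 * C1)), by positivity, min_le_left _ _, ?_⟩
    calc _ ≤ 1 / (4 * C1) * C1 := by gcongr; exact min_le_right _ _
      _ = _ := by field_simp
  obtain ⟨A₀, hA0, hA1, hA2, hA3⟩ : ∃ A₀ : ℝ, 0 < A₀ ∧ A₀ ≤ 1 ∧ β ^ 2 * A₀ ≤ 1 / 4 ∧
      C3 * A₀ ≤ 1 / 4 := by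
    refine ⟨min 1 (min (1 / (4 * β ^ 2)) (1 / (4 * C3))), by positivity, min_le_left _ _, ?_, ?_⟩
    · calc _ ≤ β ^ 2 * (1 / (4 * β ^ 2)) := by
            gcongr; exact (min_le_right _ _).trans (min_le_left _ _)
        _ = _ := by field_simp
    · calc _ ≤ C3 * (1 / (4 * C3)) := by
            gcongr; exact (min_le_right _ _).trans (min_le_right _ _)
        _ = _ := by field_simp
  obtain ⟨Q, hQ⟩ : ∃ Q, Q = 8 * (C1 / A₀ + C3 + 1 / A₀) / (ε * β) := ⟨_, rfl⟩
  refine ⟨ε, k, A₀, Q, max 1 (max (2 / β) (8 / ε)), hε0, hk0, hA0, by rw [hQ]; positivity,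
    le_max_left _ _, ?_⟩
  intro A z N m P q hA hN hm hN4 hmM hP hP' hq hqA
  have hP0 : 0 ≤ P := le_trans (by positivity) hP
  -- elementary facts
  have hAm : A * m ≤ 1 := by
    have : (A * m) ^ 2 ≤ 1 ^ 2 := by
      have : m ^ 2 * A ^ 2 + m ^ 2 + m ^ 2 * (16 * z ^ 2) = 1 := by rw [← hmM, hN4]; ring
      nlinarith [sq_nonneg (m * z), sq_nonneg m]
    exact (abs_le_of_sq_le_sq' this (by norm_num)).2
  have hzm : z ^ 2 * m ^ 2 ≤ 1 / 16 := by
    have : m ^ 2 * A ^ 2 + m ^ 2 + m ^ 2 * (16 * z ^ 2) = 1 := by rw [← hmM, hN4]; ring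
    nlinarith [sq_nonneg (m * A), sq_nonneg m]
  have hAm0 : 0 < A * m := by positivity
  have hAN : A ≤ N ^ 2 := by
    have : A ^ 2 ≤ (N ^ 2) ^ 2 := by nlinarith [sq_nonneg z]
    exact (abs_le_of_sq_le_sq' this (by positivity)).2
  obtain ⟨h, hh⟩ : ∃ h, h = 1 / (1 + A) := ⟨_, rfl⟩
  have hh0 : 0 < h := by rw [hh]; positivity
  have hh1 : h ≤ 1 := by rw [hh, div_le_one (by positivity)]; linarith
  have hhA : h * (1 + A) = 1 := by rw [hh]; field_simp
  have hhA1 : A * h ≤ 1 := by linarith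
  have hae : aF ε A m = ε * (A * m) - h := by rw [aF, hh]
  have hεAm : ε * (A * m) ≤ ε := by nlinarith
  have hεAm0 : 0 ≤ ε * (A * m) := by positivity
  -- bound for G
  have hG1 : RaF ε A m + d * aF ε A m + TbF ε k z m P ≤ ε * C1 - 2 * h := by
    have e1 : RaF ε A m = ε * (2 * (A * m) - 2 * (A * m) ^ 3) + 2 * h * (A * h) := by
      rw [RaF, hh]; field_simp; ring
    have e2 : TbF ε k z m P = ε * k * (P * m - 16 * (z ^ 2 * m ^ 2) * (P * m)) := by
      rw [TbF]; ring
    have hPm : P * m ≤ l' := by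
      calc P * m ≤ l' * A * m := by gcongr
        _ = l' * (A * m) := by ring
        _ ≤ l' * 1 := by gcongr
        _ = l' := by ring
    have hPm0 : 0 ≤ P * m := by positivity
    have b1 : RaF ε A m ≤ ε * 2 + 2 * h := by
      rw [e1]
      have : 2 * (A * m) - 2 * (A * m) ^ 3 ≤ 2 := by linarith [pow_pos hAm0 3]
      have := mul_le_mul_of_nonneg_left this hε0.le
      have : 2 * h * (A * h) ≤ 2 * h * 1 := by gcongr
      linarith
    have b2 : d * aF ε A m ≤ ε * d - 4 * h := by
      rw [hae]
      have : d * (ε * (A * m)) ≤ d * ε := by gcongr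
      have : 4 * h ≤ d * h := by gcongr
      linarith
    have b3 : TbF ε k z m P ≤ ε * (k * l') := by
      rw [e2]
      have : P * m - 16 * (z ^ 2 * m ^ 2) * (P * m) ≤ l' := by
        have : 0 ≤ (z ^ 2 * m ^ 2) * (P * m) := by positivity
        linarith
      calc _ ≤ ε * k * l' := by gcongr
        _ = _ := by ring
    rw [hC1]; linarith
  have hG2 : aF ε A m ^ 2 * q + bF ε k z m ^ 2 * P ≤ C3 * A := by
    have c1 : aF ε A m ^ 2 ≤ 1 := by
      have : |aF ε A m| ≤ 1 := by rw [hae, abs_le]; constructor <;> linarith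
      exact (sq_le_one_iff_abs_le_one _).2 this
    have c2 : bF ε k z m ^ 2 ≤ k ^ 2 := by
      have : bF ε k z m ^ 2 = ε ^ 2 * k ^ 2 * (z ^ 2 * m ^ 2) := by rw [bF]; ring
      rw [this]
      have e2 : ε ^ 2 ≤ 1 := by nlinarith
      calc _ ≤ 1 * k ^ 2 * 1 := by gcongr; linarith
        _ = _ := by ring
    have c3 : q ≤ 1 / l * A := by
      rw [one_div, ← div_eq_inv_mul, le_div_iff₀ hl]; linarith
    calc _ ≤ 1 * (1 / l * A) + k ^ 2 * (l' * A) := by gcongr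
      _ = C3 * A := by rw [hC3]; ring
  have hG : GF d ε k A z m P q ≤ ε * C1 - 2 * h + C3 * A := by rw [GF]; linarith
  -- bound for E
  obtain ⟨u, hu⟩ : ∃ u, u = 1 / N ^ 3 := ⟨_, rfl⟩
  have hu0 : 0 < u := by rw [hu]; positivity
  have huN : u * N ^ 4 = N := by rw [hu]; field_simp
  have huN3 : u * N ^ 3 = 1 := by rw [hu]; field_simp
  have hEeq : EF ε k β A z N m P = ε * m * (β * u * (A ^ 3 + 8 * k * z ^ 2 * P) - A) +
      h * (1 - β * u * A ^ 2) := by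
    have d1 : A ^ 2 / N ^ 3 = u * A ^ 2 := by rw [hu]; ring
    have d2 : 8 * z * P / N ^ 3 = u * (8 * z * P) := by rw [hu]; ring
    rw [EF, hae, bF, d1, d2]; ring
  have hE1 : ε * m * A * (β * N - 1) + h * (1 - β * u * A ^ 2) ≤ EF ε k β A z N m P := by
    rw [hEeq]
    have : A * N ^ 4 ≤ A ^ 3 + 8 * k * z ^ 2 * P := by
      have : 8 * k * z ^ 2 * (l * A) ≤ 8 * k * z ^ 2 * P := by gcongr
      have h2 : 8 * k * z ^ 2 * (l * A) = 16 * z ^ 2 * A := by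
        calc _ = 8 * (k * l) * z ^ 2 * A := by ring
          _ = _ := by rw [hkl]; ring
      rw [hN4]; linarith
    have : β * u * (A * N ^ 4) ≤ β * u * (A ^ 3 + 8 * k * z ^ 2 * P) := by gcongr
    have h3 : β * u * (A * N ^ 4) = A * (β * N) := by
      calc _ = A * (β * (u * N ^ 4)) := by ring
        _ = _ := by rw [huN]
    have : ε * m * (A * (β * N) - A) ≤ ε * m * (β * u * (A ^ 3 + 8 * k * z ^ 2 * P) - A) := by
      apply mul_le_mul_of_nonneg_left (by linarith) (by positivity)
    linarith
  refine ⟨?_, ?_, ?_, ?_⟩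
  · intro vp hvp hAA
    have hh2 : 1 / 2 ≤ h := by
      rw [hh]; apply one_div_le_one_div_of_le (by positivity); linarith
    have hA2u : β * u * A ^ 2 ≤ 1 / 2 := by
      have : (β * u * A ^ 2) ^ 2 ≤ (1 / 2) ^ 2 := by
        have e : (β * u * A ^ 2) ^ 2 = β ^ 2 * A * (u ^ 2 * A ^ 3) := by ring
        have : u ^ 2 * A ^ 3 ≤ 1 := by
          calc u ^ 2 * A ^ 3 ≤ u ^ 2 * (N ^ 2) ^ 3 := by gcongr
            _ = (u * N ^ 3) ^ 2 := by ring
            _ = 1 := by rw [huN3]; norm_num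
        rw [e]
        calc _ ≤ β ^ 2 * A₀ * 1 := by gcongr
          _ ≤ _ := by linarith
      exact (abs_le_of_sq_le_sq' this (by norm_num)).2
    have hE : 0 ≤ EF ε k β A z N m P := by
      refine le_trans ?_ hE1
      have : 0 ≤ ε * m * A * (β * N) := by positivity
      have : (1 / 2) * (1 / 2) ≤ h * (1 - β * u * A ^ 2) := by
        apply mul_le_mul hh2 (by linarith) (by norm_num) hh0.le
      linarith
    have := mul_nonneg hvp hE
    have : C3 * A ≤ C3 * A₀ := by gcongr
    linarith
  · intro vp hAA hNN hvp
    have hN1 : 1 ≤ N := (le_max_left _ _).trans hNN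
    have hN2 : 2 / β ≤ N := ((le_max_left _ _).trans (le_max_right _ _)).trans hNN
    have hN3 : 8 / ε ≤ N := ((le_max_right _ _).trans (le_max_right _ _)).trans hNN
    rw [div_le_iff₀ hβ] at hN2
    rw [div_le_iff₀ hε0] at hN3
    have hmN : 1 / 2 ≤ m * N ^ 2 := by
      by_contra hcon
      push Not at hcon
      have h1 : (m * N ^ 2) ^ 2 < (1 / 2) ^ 2 := by
        apply pow_lt_pow_left₀ hcon (by positivity) (by norm_num)
      have h2 : m ^ 2 * 1 ≤ m ^ 2 * N ^ 4 := by gcongr; exact one_le_pow₀ hN1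
      have h3 : (m * N ^ 2) ^ 2 = m ^ 2 * N ^ 4 := by ring
      linarith
    have hE : ε * β * A / (8 * N) ≤ EF ε k β A z N m P := by
      refine le_trans ?_ hE1
      have s1 : ε * A * β / (4 * N) ≤ ε * m * A * (β * N - 1) := by
        have : β * N / 2 ≤ β * N - 1 := by linarith
        calc ε * A * β / (4 * N) = ε * A * β / (2 * N) * (1 / 2) := by field_simp; norm_num
          _ ≤ ε * A * β / (2 * N) * (m * N ^ 2) := by gcongr
          _ = ε * m * A * (β * N / 2) := by field_simp
          _ ≤ _ := by gcongr
      have s2 : h * (β * u * A ^ 2) ≤ ε * A * β / (8 * N) := by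
        calc h * (β * u * A ^ 2) = (A * h) * (β * A * u) := by ring
          _ ≤ 1 * (β * A * u) := by gcongr
          _ = β * A / N ^ 3 := by rw [hu]; ring
          _ ≤ _ := by
            rw [div_le_div_iff₀ (by positivity) (by positivity)]
            have : 8 ≤ ε * N ^ 2 := by
              have : N * ε * 1 ≤ N * ε * N := by gcongr
              linarith
            have : 8 * (β * A * N) ≤ ε * N ^ 2 * (β * A * N) := by gcongr
            linarith
      have s3 : ε * A * β / (4 * N) = ε * A * β / (8 * N) + ε * A * β / (8 * N) := by
        field_simp; norm_num
      have s4 : ε * β * A / (8 * N) = ε * A * β / (8 * N) := by ring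
      rw [s4]
      have s5 : h * (1 - β * u * A ^ 2) = h - h * (β * u * A ^ 2) := by ring
      linarith
    have hQ0 : 0 < Q := by rw [hQ]; positivity
    have hvE : Q * N * (ε * β * A / (8 * N)) ≤ vp * EF ε k β A z N m P := by
      apply mul_le_mul hvp hE (by positivity)
      exact le_trans (by positivity) hvp
    have hQe : Q * N * (ε * β * A / (8 * N)) = A * (C1 / A₀) + C3 * A + A * (1 / A₀) := by
      rw [hQ]; field_simp
    have t1 : 1 ≤ A * (1 / A₀) := by
      rw [mul_one_div, le_div_iff₀ hA0]; linarith
    have t2 : C1 ≤ A * (C1 / A₀) := by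
      rw [mul_div_assoc', le_div_iff₀ hA0]; linarith [mul_le_mul_of_nonneg_right hAA hC1p.le]
    have t3 : ε * C1 ≤ C1 := by
      linarith [mul_le_mul_of_nonneg_right (show ε ≤ 1 by linarith) hC1p.le]
    linarith
  · intro hAA
    have hh2 : 1 / 2 ≤ h := by
      rw [hh]; apply one_div_le_one_div_of_le (by positivity); linarith
    rw [hae]; linarith
  · rw [hae, bF]
    have : 0 ≤ ε * (A * m) * (4 * A ^ 2) := by positivity
    have e : ε * k * (z * m) * (32 * z * P) = 32 * (ε * k * m * z ^ 2 * P) := by ring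
    have : 0 ≤ ε * k * m * z ^ 2 * P := by positivity
    have : h * (4 * A ^ 2) = 4 * A * (A * h) := by ring
    have : 4 * A * (A * h) ≤ 4 * A * 1 := by gcongr
    linarith

/-- the growth condition gives a lower bound for the derivative far away -/
lemma growth {β l Q : ℝ} (hβ : 0 < β) (hl : 0 < l) {V' : ℝ → ℝ}
    (hgrow : Tendsto (fun s => V' s / s ^ 2) atTop atTop) :
    ∃ N₂ : ℝ, ∀ N q : ℝ, N₂ ≤ N → 0 < q → l * q ≤ N ^ 2 →
      Q * N ≤ V' (β * N - 1 / 2 * Real.log q) := by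
  obtain ⟨s₁, hs₁⟩ := eventually_atTop.1 (hgrow.eventually_ge_atTop 1)
  have hlog : ∀ᶠ N : ℝ in atTop, Real.log N ≤ β / 4 * N := by
    have := Real.isLittleO_log_id_atTop.bound (c := β / 4) (by positivity)
    filter_upwards [this, eventually_ge_atTop 1] with N h1 h2
    have : ‖Real.log N‖ = Real.log N := by
      rw [Real.norm_eq_abs, abs_of_nonneg (Real.log_nonneg h2)]
    rw [this] at h1
    simpa [abs_of_nonneg (by linarith : (0:ℝ) ≤ N)] using h1
  obtain ⟨N₃, hN₃⟩ := eventually_atTop.1 hlog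
  refine ⟨max 1 (max N₃ (max (-(2 * Real.log l) / β) (max (2 * (max s₁ 1) / β)
    (4 * Q / β ^ 2)))), ?_⟩
  intro N q hN hq hqN
  simp only [max_le_iff] at hN
  obtain ⟨hN1, hNa, hNb, hNc, hNd⟩ := hN
  have hlN := hN₃ N hNa
  rw [div_le_iff₀ (by positivity)] at hNb hNc hNd
  have hlq : Real.log l + Real.log q ≤ 2 * Real.log N := by
    rw [← Real.log_mul hl.ne' hq.ne']
    calc _ ≤ Real.log (N ^ 2) := Real.log_le_log (by positivity) hqN
      _ = _ := by rw [Real.log_pow]; norm_num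
  obtain ⟨s, hs⟩ : ∃ s, s = β * N - 1 / 2 * Real.log q := ⟨_, rfl⟩
  rw [← hs]
  have hsN : β * N / 2 ≤ s := by rw [hs]; linarith
  have h1 : s₁ ≤ s := by have := le_max_left s₁ 1; linarith
  have h2 : 1 ≤ s := by have := le_max_right s₁ 1; linarith
  have h3 := hs₁ s h1
  rw [le_div_iff₀ (by positivity)] at h3
  have : (β * N / 2) ^ 2 ≤ s ^ 2 := by gcongr
  have : Q * N ≤ (β * N / 2) ^ 2 := by nlinarith
  linarith

noncomputable def AG {n : ℕ} (L : Fin n → ℝ) (p : PtG n) : ℝ := 2 * SG L p.1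
noncomputable def MG {n : ℕ} (L : Fin n → ℝ) (p : PtG n) : ℝ := 1 + (AG L p ^ 2 + 16 * p.2 ^ 2)
noncomputable def mG {n : ℕ} (L : Fin n → ℝ) (p : PtG n) : ℝ := (√(MG L p))⁻¹
noncomputable def sG {n : ℕ} (L : Fin n → ℝ) (β : ℝ) (p : PtG n) : ℝ :=
  β * NG L p - 1 / 2 * Real.log (qG p.1)

lemma Ulog_eq {n : ℕ} (L : Fin n → ℝ) (β : ℝ) (V : ℝ → ℝ) (p : PtG n) :
    Ulog L β V p = V (sG L β p) := by
  unfold Ulog sG xnormG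
  change V (β * NG L p + Real.log (1 / √(qG p.1))) = _
  rw [one_div, Real.log_inv, Real.log_sqrt (qG_nonneg _)]
  congr 1; ring

lemma AG_nonneg {n : ℕ} (L : Fin n → ℝ) (p : PtG n) : 0 ≤ AG L p := by
  have := SG_nonneg L p.1
  unfold AG; positivity

lemma MG_pos {n : ℕ} (L : Fin n → ℝ) (p : PtG n) : 0 < MG L p := by
  unfold MG; positivity

lemma contDiff_AG {n : ℕ} (L : Fin n → ℝ) {m} : ContDiff ℝ m (AG L) := by
  unfold AG
  exact contDiff_const.mul ((contDiff_SG L).comp contDiff_fst)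

lemma contDiff_MG {n : ℕ} (L : Fin n → ℝ) {m} : ContDiff ℝ m (MG L) := by
  have := contDiff_AG L (m := m)
  unfold MG; fun_prop

lemma contDiff_mG {n : ℕ} (L : Fin n → ℝ) {m} : ContDiff ℝ m (mG L) := by
  unfold mG
  exact ((contDiff_MG L).sqrt fun p => (MG_pos L p).ne').inv
    fun p => (Real.sqrt_pos.2 (MG_pos L p)).ne'

lemma contDiff_a {n : ℕ} (L : Fin n → ℝ) (ε : ℝ) {m} :
    ContDiff ℝ m fun p => aF ε (AG L p) (mG L p) := by
  unfold aF
  have h1 := contDiff_AG L (m := m)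
  have h2 := contDiff_mG L (m := m)
  refine (contDiff_const.mul (h1.mul h2)).sub (contDiff_const.div (contDiff_const.add h1) ?_)
  intro p
  have := AG_nonneg L p
  positivity

lemma contDiff_b {n : ℕ} (L : Fin n → ℝ) (ε k : ℝ) {m} :
    ContDiff ℝ m fun p : PtG n => bF ε k p.2 (mG L p) := by
  unfold bF
  have h2 := contDiff_mG L (m := m)
  fun_prop

lemma NG_eq {n : ℕ} (L : Fin n → ℝ) (p : PtG n) :
    NG L p = (AG L p ^ 2 + 16 * p.2 ^ 2) ^ ((1 : ℝ) / 4) := rfl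

lemma NG_nonneg {n : ℕ} (L : Fin n → ℝ) (p : PtG n) : 0 ≤ NG L p := by
  rw [NG_eq]; positivity

lemma NG_pow {n : ℕ} (L : Fin n → ℝ) (p : PtG n) :
    NG L p ^ 4 = AG L p ^ 2 + 16 * p.2 ^ 2 := by
  rw [NG_eq, ← Real.rpow_natCast, ← Real.rpow_mul (by positivity)]
  norm_num

lemma NG_pos {n : ℕ} (L : Fin n → ℝ) (p : PtG n) (h : 0 < AG L p) : 0 < NG L p := by
  rw [NG_eq]; positivity

lemma continuous_NG {n : ℕ} (L : Fin n → ℝ) : Continuous (NG L) := by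
  have h := (contDiff_AG L (m := 1)).continuous
  have : NG L = fun p => (AG L p ^ 2 + 16 * p.2 ^ 2) ^ ((1 : ℝ) / 4) := rfl
  rw [this]
  exact Continuous.rpow_const (by fun_prop) fun p => Or.inr (by norm_num)

lemma contDiffAt_NG {n : ℕ} (L : Fin n → ℝ) (p : PtG n) (h : 0 < AG L p) {m} :
    ContDiffAt ℝ m (NG L) p := by
  have : NG L = fun p => (AG L p ^ 2 + 16 * p.2 ^ 2) ^ ((1 : ℝ) / 4) := rfl
  rw [this]
  have h1 := contDiff_AG L (m := m)
  refine ContDiffAt.rpow_const_of_ne ?_ ?_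
  · exact ContDiff.contDiffAt (by fun_prop)
  · positivity

lemma mG_sq {n : ℕ} (L : Fin n → ℝ) (p : PtG n) :
    mG L p ^ 2 * (1 + NG L p ^ 4) = 1 := by
  rw [NG_pow, mG, inv_pow, Real.sq_sqrt (MG_pos L p).le]
  exact inv_mul_cancel₀ (MG_pos L p).ne'

lemma mG_pos {n : ℕ} (L : Fin n → ℝ) (p : PtG n) : 0 < mG L p := by
  have := MG_pos L p
  unfold mG; positivity

lemma contDiffAt_sG {n : ℕ} (L : Fin n → ℝ) (β : ℝ) (p : PtG n) (h : 0 < AG L p)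
    (hq : 0 < qG p.1) {m} : ContDiffAt ℝ m (sG L β) p := by
  unfold sG
  refine (contDiffAt_const.mul (contDiffAt_NG L p h)).sub (contDiffAt_const.mul ?_)
  exact ((contDiff_qG.comp contDiff_fst).contDiffAt).log hq.ne'

lemma hd_A_R {n : ℕ} (L : Fin n → ℝ) (p : PtG n) :
    HasDerivAt (fun τ : ℝ => AG L (p + τ • ((p.1, 0) : PtG n))) (2 * AG L p) 0 := by
  have : (fun τ : ℝ => AG L (p + τ • ((p.1, 0) : PtG n))) = fun τ => (1 + τ) ^ 2 * AG L p := by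
    ext τ
    simp only [AG, Prod.fst_add, Prod.smul_fst, SG_radial]; ring
  rw [this]
  have h := (((hasDerivAt_id (0:ℝ)).const_add 1).pow 2).mul_const (AG L p)
  simpa using h

lemma hd_A_T {n : ℕ} (L : Fin n → ℝ) (p : PtG n) :
    HasDerivAt (fun τ : ℝ => AG L (p + τ • ((Yv L p.1, PG L p.1) : PtG n))) 0 0 := by
  have : (fun τ : ℝ => AG L (p + τ • ((Yv L p.1, PG L p.1) : PtG n))) =
      fun τ => AG L p + τ ^ 2 * (2 * SG L (Yv L p.1)) := by
    ext τ
    simp only [AG, Prod.fst_add, Prod.smul_fst, SG_rot]; ring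
  rw [this]
  have h := (((hasDerivAt_id (0:ℝ)).pow 2).mul_const (2 * SG L (Yv L p.1))).const_add (AG L p)
  simpa using h

lemma hd_q_R {n : ℕ} (p : PtG n) :
    HasDerivAt (fun τ : ℝ => qG (p + τ • ((p.1, 0) : PtG n)).1) (2 * qG p.1) 0 := by
  have : (fun τ : ℝ => qG (p + τ • ((p.1, 0) : PtG n)).1) = fun τ => (1 + τ) ^ 2 * qG p.1 := by
    ext τ
    simp only [Prod.fst_add, Prod.smul_fst, qG_radial]
  rw [this]
  have h := (((hasDerivAt_id (0:ℝ)).const_add 1).pow 2).mul_const (qG p.1)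
  simpa using h

lemma hd_q_T {n : ℕ} (L : Fin n → ℝ) (p : PtG n) :
    HasDerivAt (fun τ : ℝ => qG (p + τ • ((Yv L p.1, PG L p.1) : PtG n)).1) 0 0 := by
  have : (fun τ : ℝ => qG (p + τ • ((Yv L p.1, PG L p.1) : PtG n)).1) =
      fun τ => qG p.1 + τ ^ 2 * qG (Yv L p.1) := by
    ext τ
    simp only [Prod.fst_add, Prod.smul_fst, qG_rot]
  rw [this]
  have h := (((hasDerivAt_id (0:ℝ)).pow 2).mul_const (qG (Yv L p.1))).const_add (qG p.1)
  simpa using h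

lemma hd_z {n : ℕ} (p v : PtG n) : HasDerivAt (fun τ : ℝ => (p + τ • v).2) v.2 0 := by
  have h := ((hasDerivAt_id (0:ℝ)).mul_const v.2).const_add p.2
  simpa using h

lemma hd_W {n : ℕ} {L : Fin n → ℝ} {p v : PtG n} {A' : ℝ}
    (hA : HasDerivAt (fun τ : ℝ => AG L (p + τ • v)) A' 0) :
    HasDerivAt (fun τ : ℝ => AG L (p + τ • v) ^ 2 + 16 * (p + τ • v).2 ^ 2)
      (2 * AG L p * A' + 32 * p.2 * v.2) 0 := by
  have h := (hA.pow 2).add (((hd_z p v).pow 2).const_mul 16)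
  refine h.congr_deriv ?_
  simp; ring

lemma hd_N {n : ℕ} {L : Fin n → ℝ} {p v : PtG n} {A' : ℝ} (hp : 0 < AG L p)
    (hA : HasDerivAt (fun τ : ℝ => AG L (p + τ • v)) A' 0) :
    HasDerivAt (fun τ : ℝ => NG L (p + τ • v))
      ((2 * AG L p * A' + 32 * p.2 * v.2) / (4 * NG L p ^ 3)) 0 := by
  have h := (hd_W hA).rpow_const (p := (1:ℝ) / 4) (Or.inl (by simp; positivity))
  refine h.congr_deriv ?_
  simp only [zero_smul, add_zero]
  have e : (AG L p ^ 2 + 16 * p.2 ^ 2) ^ ((1:ℝ) / 4 - 1) = (NG L p ^ 3)⁻¹ := by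
    rw [NG_eq]
    have h0 : 0 ≤ AG L p ^ 2 + 16 * p.2 ^ 2 := by positivity
    generalize AG L p ^ 2 + 16 * p.2 ^ 2 = w at h0
    rw [← Real.rpow_natCast, ← Real.rpow_mul h0, ← Real.rpow_neg h0]
    norm_num
  rw [e]
  have := NG_pos L p hp
  field_simp

lemma hd_m {n : ℕ} {L : Fin n → ℝ} {p v : PtG n} {A' : ℝ}
    (hA : HasDerivAt (fun τ : ℝ => AG L (p + τ • v)) A' 0) :
    HasDerivAt (fun τ : ℝ => mG L (p + τ • v))
      (-(1 / 2) * mG L p ^ 3 * (2 * AG L p * A' + 32 * p.2 * v.2)) 0 := by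
  have hM := MG_pos L p
  have h := (((hd_W hA).const_add 1).sqrt (by simp; positivity)).inv
    (by simp only [zero_smul, add_zero]; exact (Real.sqrt_pos.2 hM).ne')
  refine h.congr_deriv ?_
  simp only [zero_smul, add_zero, mG]
  have e : 1 + (AG L p ^ 2 + 16 * p.2 ^ 2) = MG L p := rfl
  rw [e]
  have := Real.sqrt_pos.2 hM
  field_simp

lemma hd_a {n : ℕ} {L : Fin n → ℝ} {p v : PtG n} {A' : ℝ} (ε : ℝ)
    (hA : HasDerivAt (fun τ : ℝ => AG L (p + τ • v)) A' 0) :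
    HasDerivAt (fun τ : ℝ => aF ε (AG L (p + τ • v)) (mG L (p + τ • v)))
      (ε * (A' * mG L p + AG L p * (-(1 / 2) * mG L p ^ 3 * (2 * AG L p * A' + 32 * p.2 * v.2)))
        + A' / (1 + AG L p) ^ 2) 0 := by
  have h0 := AG_nonneg L p
  have h := ((hA.mul (hd_m hA)).const_mul ε).sub ((hA.const_add 1).inv (by simp; positivity))
  have e : (fun τ : ℝ => aF ε (AG L (p + τ • v)) (mG L (p + τ • v))) = fun τ : ℝ =>
    ε * (AG L (p + τ • v) * mG L (p + τ • v)) - (1 + AG L (p + τ • v))⁻¹ := by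
    ext τ; rw [aF, one_div]
  rw [e]
  refine h.congr_deriv ?_
  simp only [zero_smul, add_zero]
  ring

lemma hd_b {n : ℕ} {L : Fin n → ℝ} {p v : PtG n} {A' : ℝ} (ε k : ℝ)
    (hA : HasDerivAt (fun τ : ℝ => AG L (p + τ • v)) A' 0) :
    HasDerivAt (fun τ : ℝ => bF ε k (p + τ • v).2 (mG L (p + τ • v)))
      (ε * k * (v.2 * mG L p +
        p.2 * (-(1 / 2) * mG L p ^ 3 * (2 * AG L p * A' + 32 * p.2 * v.2)))) 0 := by
  have h := ((hd_z p v).mul (hd_m hA)).const_mul (ε * k)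
  refine h.congr_deriv ?_
  simp only [zero_smul, add_zero]

/-- cutoff near `x = 0` -/
noncomputable def kG {n : ℕ} (L : Fin n → ℝ) (i : ℝ) (p : PtG n) : ℝ :=
  Real.smoothTransition (i * AG L p - 1)
/-- cutoff at infinity -/
noncomputable def cG {n : ℕ} (L : Fin n → ℝ) (i : ℝ) (p : PtG n) : ℝ :=
  Real.smoothTransition (2 - MG L p / i)

lemma hd_st (t : ℝ) : HasDerivAt Real.smoothTransition (deriv Real.smoothTransition t) t :=
  ((Real.smoothTransition.contDiff (n := 1)).differentiable (by norm_num) t).hasDerivAt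

lemma st_deriv_nonneg (t : ℝ) : 0 ≤ deriv Real.smoothTransition t :=
  Real.smoothTransition.monotone.deriv_nonneg

lemma st_deriv_zero (t : ℝ) (ht : t < 0 ∨ 1 < t) : deriv Real.smoothTransition t = 0 := by
  rcases ht with ht | ht
  · have : Real.smoothTransition =ᶠ[nhds t] fun _ => 0 := by
      filter_upwards [Iio_mem_nhds ht] with s hs
      exact Real.smoothTransition.zero_of_nonpos (le_of_lt hs)
    rw [this.deriv_eq]; simp
  · have : Real.smoothTransition =ᶠ[nhds t] fun _ => 1 := by
      filter_upwards [Ioi_mem_nhds ht] with s hs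
      exact Real.smoothTransition.one_of_one_le (le_of_lt hs)
    rw [this.deriv_eq]; simp

lemma st_deriv_bdd : ∃ C, 0 < C ∧ ∀ t, deriv Real.smoothTransition t ≤ C := by
  have hc : Continuous (deriv Real.smoothTransition) :=
    (Real.smoothTransition.contDiff (n := 1)).continuous_deriv (by norm_num)
  obtain ⟨C, hC⟩ := (isCompact_Icc (a := (0:ℝ)) (b := 1)).exists_bound_of_continuousOn
    hc.continuousOn
  refine ⟨max C 1, by positivity, fun t => ?_⟩
  by_cases ht : t ∈ Set.Icc (0:ℝ) 1
  · exact ((le_abs_self _).trans (hC t ht)).trans (le_max_left _ _)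
  · rw [st_deriv_zero t]
    · positivity
    · simp only [Set.mem_Icc, not_and_or, not_le] at ht
      exact ht

lemma hd_k {n : ℕ} {L : Fin n → ℝ} {p v : PtG n} {A' : ℝ} (i : ℝ)
    (hA : HasDerivAt (fun τ : ℝ => AG L (p + τ • v)) A' 0) :
    HasDerivAt (fun τ : ℝ => kG L i (p + τ • v))
      (deriv Real.smoothTransition (i * AG L p - 1) * (i * A')) 0 := by
  have h := (hd_st (i * AG L (p + (0:ℝ) • v) - 1)).comp (0:ℝ) ((hA.const_mul i).sub_const 1)
  simp only [zero_smul, add_zero] at h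
  exact h

lemma hd_c {n : ℕ} {L : Fin n → ℝ} {p v : PtG n} {A' : ℝ} (i : ℝ)
    (hA : HasDerivAt (fun τ : ℝ => AG L (p + τ • v)) A' 0) :
    HasDerivAt (fun τ : ℝ => cG L i (p + τ • v))
      (deriv Real.smoothTransition (2 - MG L p / i) *
        (-((2 * AG L p * A' + 32 * p.2 * v.2) / i))) 0 := by
  have h := (hd_st (2 - MG L (p + (0:ℝ) • v) / i)).comp (0:ℝ)
    ((((hd_W hA).const_add 1).div_const i).const_sub 2)
  simp only [zero_smul, add_zero] at h
  exact h

lemma hd_s {n : ℕ} {L : Fin n → ℝ} {p v : PtG n} {A' q' : ℝ} (β : ℝ) (hp : 0 < AG L p)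
    (hq0 : 0 < qG p.1)
    (hA : HasDerivAt (fun τ : ℝ => AG L (p + τ • v)) A' 0)
    (hq : HasDerivAt (fun τ : ℝ => qG (p + τ • v).1) q' 0) :
    HasDerivAt (fun τ : ℝ => sG L β (p + τ • v))
      (β * ((2 * AG L p * A' + 32 * p.2 * v.2) / (4 * NG L p ^ 3)) - 1 / 2 * (q' / qG p.1)) 0 := by
  have h := ((hd_N hp hA).const_mul β).sub ((hq.log (by simpa using hq0.ne')).const_mul (1 / 2))
  simp only [zero_smul, add_zero] at h
  exact h

lemma hd_rho {n : ℕ} {L : Fin n → ℝ} {p v : PtG n} {s' : ℝ} {β : ℝ} {V V' : ℝ → ℝ}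
    (hV' : ∀ s : ℝ, HasDerivAt V (V' s) s)
    (hs : HasDerivAt (fun τ : ℝ => sG L β (p + τ • v)) s' 0) :
    HasDerivAt (fun τ : ℝ => Real.exp (-(V (sG L β (p + τ • v)))))
      (Real.exp (-(V (sG L β p))) * (-(V' (sG L β p) * s'))) 0 := by
  have h := ((hV' (sG L β (p + (0:ℝ) • v))).comp (0:ℝ) hs).neg.exp
  simp only [Function.comp_def, Pi.neg_apply, zero_smul, add_zero] at h
  exact h

lemma hd_g {n : ℕ} {g : PtG n → ℝ} {p v : PtG n} (hg : DifferentiableAt ℝ g p) :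
    HasDerivAt (fun τ : ℝ => g (p + τ • v)) (fderiv ℝ g p v) 0 :=
  hg.hasFDerivAt.hasLineDerivAt v

/-- product rule in a direction, for the products used below -/
lemma hd_prod {n : ℕ} {g c k x r : PtG n → ℝ} {p v : PtG n} {g' c' k' x' r' : ℝ}
    (hF : DifferentiableAt ℝ (fun p => g p ^ 2 * c p * (k p * x p * r p)) p)
    (hg : HasDerivAt (fun τ : ℝ => g (p + τ • v)) g' 0)
    (hc : HasDerivAt (fun τ : ℝ => c (p + τ • v)) c' 0)
    (hk : HasDerivAt (fun τ : ℝ => k (p + τ • v)) k' 0)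
    (hx : HasDerivAt (fun τ : ℝ => x (p + τ • v)) x' 0)
    (hr : HasDerivAt (fun τ : ℝ => r (p + τ • v)) r' 0) :
    fderiv ℝ (fun p => g p ^ 2 * c p * (k p * x p * r p)) p v =
      2 * g p * g' * c p * (k p * x p * r p) + g p ^ 2 * c' * (k p * x p * r p)
      + g p ^ 2 * c p * (k' * x p * r p + k p * x' * r p + k p * x p * r') := by
  have h1 := hd_g (v := v) hF
  have h2 := ((hg.pow 2).mul hc).mul ((hk.mul hx).mul hr)
  refine h1.unique (h2.congr_deriv ?_)
  simp only [zero_smul, add_zero, Pi.mul_apply, Pi.pow_apply]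
  ring

lemma AG_pos {n : ℕ} {L : Fin n → ℝ} {l : ℝ} (hl : 0 < l) (p : PtG n)
    (hc : l * qG p.1 ≤ 2 * SG L p.1) (hp : p.1 ≠ 0) : 0 < AG L p := by
  have := qG_pos hp
  unfold AG
  exact lt_of_lt_of_le (by positivity) hc

lemma AG_zero {n : ℕ} (L : Fin n → ℝ) (p : PtG n) (hp : p.1 = 0) : AG L p = 0 := by
  unfold AG SG; simp [hp]

/-- the density -/
noncomputable def rG {n : ℕ} (L : Fin n → ℝ) (β : ℝ) (V : ℝ → ℝ) (p : PtG n) : ℝ :=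
  Real.exp (-(V (sG L β p)))

lemma contDiffAt_rG {n : ℕ} (L : Fin n → ℝ) (β : ℝ) {V : ℝ → ℝ} (hV : ContDiff ℝ 1 V)
    (p : PtG n) (h : 0 < AG L p) (hq : 0 < qG p.1) : ContDiffAt ℝ 1 (rG L β V) p := by
  unfold rG
  exact ((hV.contDiffAt.comp p (contDiffAt_sG L β p h hq)).neg).exp

lemma contDiff_kG {n : ℕ} (L : Fin n → ℝ) (i : ℝ) : ContDiff ℝ 1 (kG L i) := by
  unfold kG
  exact (Real.smoothTransition.contDiff (n := 1)).comp
    ((contDiff_const.mul (contDiff_AG L)).sub contDiff_const)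

lemma contDiff_cG {n : ℕ} (L : Fin n → ℝ) (i : ℝ) : ContDiff ℝ 1 (cG L i) := by
  unfold cG
  exact (Real.smoothTransition.contDiff (n := 1)).comp
    (contDiff_const.sub ((contDiff_MG L).div_const i))

lemma contDiff_kcr {n : ℕ} {L : Fin n → ℝ} {l : ℝ} (hl : 0 < l)
    (hc : ∀ x, l * qG x ≤ 2 * SG L x) (β : ℝ) {V : ℝ → ℝ} (hV : ContDiff ℝ 1 V) (i : ℝ) :
    ContDiff ℝ 1 fun p => kG L i p * cG L i p * rG L β V p := by
  rw [contDiff_iff_contDiffAt]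
  intro p
  by_cases hp : p.1 = 0
  · have hA := AG_zero L p hp
    have : (fun p => kG L i p * cG L i p * rG L β V p) =ᶠ[nhds p] fun _ => 0 := by
      have hcont : ContinuousAt (fun p => i * AG L p - 1) p :=
        Continuous.continuousAt (by have := (contDiff_AG L (m := 1)).continuous; fun_prop)
      have := hcont.eventually_lt_const (u := 0) (by show i * AG L p - 1 < 0; rw [hA]; norm_num)
      filter_upwards [this] with p' hp'
      rw [kG, Real.smoothTransition.zero_of_nonpos hp'.le]; simp
    exact contDiffAt_const.congr_of_eventuallyEq this
  · exact ((contDiff_kG L i).contDiffAt.mul (contDiff_cG L i).contDiffAt).mul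
      (contDiffAt_rG L β hV p (AG_pos hl p (hc _) hp) (qG_pos hp))

lemma compact_MG {n : ℕ} {L : Fin n → ℝ} {l : ℝ} (hl : 0 < l)
    (hc : ∀ x, l * qG x ≤ 2 * SG L x) (R : ℝ) : IsCompact {p : PtG n | MG L p ≤ R} := by
  refine Metric.isCompact_of_isClosed_isBounded
    (isClosed_le (contDiff_MG L (m := 1)).continuous continuous_const) ?_
  rw [isBounded_iff_forall_norm_le]
  refine ⟨max (√(√R / l)) (√R), fun p hp => ?_⟩
  simp only [Set.mem_setOf_eq, MG] at hp
  have hA : AG L p ≤ √R := Real.le_sqrt_of_sq_le (by nlinarith [sq_nonneg p.2])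
  have hz : |p.2| ≤ √R := Real.abs_le_sqrt (by nlinarith [sq_nonneg (AG L p), sq_nonneg p.2])
  rw [Prod.norm_def]
  refine max_le_max ?_ hz
  rw [pi_norm_le_iff_of_nonneg (by positivity)]
  intro j
  refine (abs_coord_le p.1 j).trans (Real.sqrt_le_sqrt ?_)
  rw [le_div_iff₀ hl, mul_comm]
  exact (hc p.1).trans hA

lemma hcs_kcr {n : ℕ} {L : Fin n → ℝ} {l : ℝ} (hl : 0 < l)
    (hc : ∀ x, l * qG x ≤ 2 * SG L x) (β : ℝ) {V : ℝ → ℝ} {i : ℝ} (hi : 0 < i) :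
    HasCompactSupport fun p => kG L i p * cG L i p * rG L β V p := by
  refine HasCompactSupport.intro (compact_MG hl hc (2 * i)) fun p hp => ?_
  simp only [Set.mem_setOf_eq, not_le] at hp
  have : cG L i p = 0 := by
    apply Real.smoothTransition.zero_of_nonpos
    have : 2 < MG L p / i := by rw [lt_div_iff₀ hi]; linarith
    linarith
  simp [this]

/-- the key pointwise estimate -/
lemma pointwise {n : ℕ} {L : Fin n → ℝ} {p : PtG n} {β ε k i A₀ Cσ : ℝ} {V V' : ℝ → ℝ}
    {g : PtG n → ℝ}
    (hV' : ∀ s : ℝ, HasDerivAt V (V' s) s)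
    (hAp : 0 < AG L p) (hqp : 0 < qG p.1) (hi : 0 < i) (hiA : 2 / i ≤ A₀)
    (hCσ : ∀ t, deriv Real.smoothTransition t ≤ Cσ) (hCσ0 : 0 < Cσ)
    (hg : DifferentiableAt ℝ g p)
    (hF1 : DifferentiableAt ℝ (fun p => g p ^ 2 * aF ε (AG L p) (mG L p) *
      (kG L i p * cG L i p * rG L β V p)) p)
    (hF2 : DifferentiableAt ℝ (fun p => g p ^ 2 * bF ε k p.2 (mG L p) *
      (kG L i p * cG L i p * rG L β V p)) p)
    (ha : AG L p ≤ A₀ → aF ε (AG L p) (mG L p) ≤ 0)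
    (hM : - (4 * AG L p) ≤ aF ε (AG L p) (mG L p) * (4 * AG L p ^ 2) +
      bF ε k p.2 (mG L p) * (32 * p.2 * PG L p.1)) :
    fderiv ℝ (fun p => g p ^ 2 * aF ε (AG L p) (mG L p) *
      (kG L i p * cG L i p * rG L β V p)) p (p.1, 0) +
    (2 * n) * (g p ^ 2 * aF ε (AG L p) (mG L p) * (kG L i p * cG L i p * rG L β V p)) +
    fderiv ℝ (fun p => g p ^ 2 * bF ε k p.2 (mG L p) *
      (kG L i p * cG L i p * rG L β V p)) p (Yv L p.1, PG L p.1) ≤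
    kG L i p * cG L i p * rG L β V p * (gradSqG L g p - g p ^ 2 *
      (V' (sG L β p) * EF ε k β (AG L p) p.2 (NG L p) (mG L p) (PG L p.1) -
        GF (2 * n) ε k (AG L p) p.2 (mG L p) (PG L p.1) (qG p.1))) +
    g p ^ 2 * rG L β V p * (8 * Cσ / √i) := by
  have hNp := NG_pos L p hAp
  rw [hd_prod hF1 (hd_g hg) (hd_a ε (hd_A_R L p)) (hd_k i (hd_A_R L p)) (hd_c i (hd_A_R L p))
    (hd_rho hV' (hd_s β hAp hqp (hd_A_R L p) (hd_q_R p))),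
    hd_prod hF2 (hd_g hg) (hd_b ε k (hd_A_T L p)) (hd_k i (hd_A_T L p)) (hd_c i (hd_A_T L p))
    (hd_rho hV' (hd_s β hAp hqp (hd_A_T L p) (hd_q_T L p)))]
  change _ + _ + _ ≤ _
  have er : Real.exp (-(V (sG L β p))) = rG L β V p := rfl
  rw [er]
  have e1 : (1:ℝ) / 2 * (2 * qG p.1 / qG p.1) = 1 := by field_simp
  have e2 : (2 * AG L p * (2 * AG L p) + 32 * p.2 * 0) / (4 * NG L p ^ 3) =
    AG L p ^ 2 / NG L p ^ 3 := by field_simp; ring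
  have e3 : (2 * AG L p * 0 + 32 * p.2 * PG L p.1) / (4 * NG L p ^ 3) =
    8 * p.2 * PG L p.1 / NG L p ^ 3 := by field_simp; ring
  simp only [e1, e2, e3]
  -- the horizontal derivative
  have hgrad : 2 * g p * (aF ε (AG L p) (mG L p) * fderiv ℝ g p (p.1, 0) +
      bF ε k p.2 (mG L p) * fderiv ℝ g p (Yv L p.1, PG L p.1)) ≤
      gradSqG L g p + g p ^ 2 * (aF ε (AG L p) (mG L p) ^ 2 * qG p.1 +
        bF ε k p.2 (mG L p) ^ 2 * PG L p.1) := by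
    generalize aF ε (AG L p) (mG L p) = a
    generalize bF ε k p.2 (mG L p) = b
    have ho := om_self L p.1
    have hW : a * fderiv ℝ g p (p.1, 0) + b * fderiv ℝ g p (Yv L p.1, PG L p.1) =
        fderiv ℝ g p (a • p.1 + b • Yv L p.1, om L (a • p.1 + b • Yv L p.1) p.1) := by
      have : ((a • p.1 + b • Yv L p.1, om L (a • p.1 + b • Yv L p.1) p.1) : PtG n) =
          a • ((p.1, 0) : PtG n) + b • ((Yv L p.1, PG L p.1) : PtG n) := by
        ext1
        · simp
        · have : om L (a • p.1 + b • Yv L p.1) p.1 = a * om L p.1 p.1 + b * PG L p.1 := by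
            simp only [om, PG, Finset.mul_sum, ← Finset.sum_add_distrib, Pi.add_apply,
              Pi.smul_apply, smul_eq_mul]
            exact Finset.sum_congr rfl fun _ _ => by ring
          simp [this, ho]
      rw [this, map_add, map_smul, map_smul, smul_eq_mul, smul_eq_mul]
    have hq : qG (a • p.1 + b • Yv L p.1) = a ^ 2 * qG p.1 + b ^ 2 * PG L p.1 := by
      have : qG (a • p.1 + b • Yv L p.1) = a ^ 2 * qG p.1 + b ^ 2 * PG L p.1 +
          2 * a * b * om L p.1 p.1 := by
        simp only [qG, om, PG, Finset.mul_sum, ← Finset.sum_add_distrib, Pi.add_apply,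
              Pi.smul_apply, smul_eq_mul]
        exact Finset.sum_congr rfl fun _ _ => by ring
      rw [this, ho]; ring
    have h1 := horizontal_sq_le L g p (a • p.1 + b • Yv L p.1)
    rw [← hW, hq] at h1
    have hG0 : 0 ≤ gradSqG L g p := by unfold gradSqG; positivity
    have hK0 : 0 ≤ a ^ 2 * qG p.1 + b ^ 2 * PG L p.1 := by
      have := qG_nonneg p.1
      have : 0 ≤ PG L p.1 := by unfold PG; positivity
      positivity
    generalize a * fderiv ℝ g p (p.1, 0) + b * fderiv ℝ g p (Yv L p.1, PG L p.1) = D at *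
    generalize a ^ 2 * qG p.1 + b ^ 2 * PG L p.1 = K at *
    generalize gradSqG L g p = G at *
    have h2 : (2 * g p * D) ^ 2 ≤ (G + g p ^ 2 * K) ^ 2 := by
      have : g p ^ 2 * D ^ 2 ≤ g p ^ 2 * (K * G) := by gcongr
      nlinarith [sq_nonneg (G - g p ^ 2 * K)]
    exact (abs_le_of_sq_le_sq' h2 (by positivity)).2
  have hk0 : 0 ≤ kG L i p := Real.smoothTransition.nonneg _
  have hk1 : kG L i p ≤ 1 := Real.smoothTransition.le_one _
  have hc0 : 0 ≤ cG L i p := Real.smoothTransition.nonneg _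
  have hc1 : cG L i p ≤ 1 := Real.smoothTransition.le_one _
  have hr0 : 0 ≤ rG L β V p := (Real.exp_pos _).le
  -- the cutoff near zero
  have hcut1 : deriv Real.smoothTransition (i * AG L p - 1) * (i * (2 * AG L p)) *
      aF ε (AG L p) (mG L p) ≤ 0 := by
    by_cases hcase : i * AG L p - 1 ≤ 1
    · have : AG L p ≤ A₀ := by
        refine le_trans ?_ hiA
        rw [le_div_iff₀ hi]; linarith
      exact mul_nonpos_of_nonneg_of_nonpos
        (mul_nonneg (st_deriv_nonneg _) (by positivity)) (ha this)
    · rw [st_deriv_zero _ (Or.inr (not_le.1 hcase))]; simp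
  -- the cutoff at infinity
  have hcut2 : deriv Real.smoothTransition (2 - MG L p / i) *
      (-((aF ε (AG L p) (mG L p) * (4 * AG L p ^ 2) +
      bF ε k p.2 (mG L p) * (32 * p.2 * PG L p.1)) / i)) ≤ 8 * Cσ / √i := by
    by_cases hcase : 0 ≤ 2 - MG L p / i
    · have h1 : MG L p ≤ 2 * i := by rw [← div_le_iff₀ hi]; linarith
      have h2 : AG L p ≤ 2 * √i := by
        have : AG L p ^ 2 ≤ (2 * √i) ^ 2 := by
          rw [mul_pow, Real.sq_sqrt hi.le]
          unfold MG at h1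
          nlinarith [sq_nonneg p.2]
        exact (abs_le_of_sq_le_sq' this (by positivity)).2
      have h3 : -((aF ε (AG L p) (mG L p) * (4 * AG L p ^ 2) +
        bF ε k p.2 (mG L p) * (32 * p.2 * PG L p.1)) / i) ≤ 8 * √i / i := by
        rw [← neg_div]; gcongr; linarith
      calc _ ≤ deriv Real.smoothTransition (2 - MG L p / i) * (8 * √i / i) :=
            mul_le_mul_of_nonneg_left h3 (st_deriv_nonneg _)
        _ ≤ Cσ * (8 * √i / i) := by gcongr; exact hCσ _
        _ = 8 * Cσ / √i := by
          have hs := Real.sqrt_pos.2 hi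
          have : i = √i * √i := (Real.mul_self_sqrt hi.le).symm
          rw [eq_div_iff hs.ne']
          calc _ = Cσ * 8 * (√i * √i) / i := by ring
            _ = _ := by rw [← this]; field_simp
    · rw [st_deriv_zero _ (Or.inl (not_le.1 hcase))]
      simp; positivity
  have hRa : ε * (2 * AG L p * mG L p + AG L p * (-(1 / 2) * mG L p ^ 3 *
        (2 * AG L p * (2 * AG L p) + 32 * p.2 * 0))) + 2 * AG L p / (1 + AG L p) ^ 2 =
      RaF ε (AG L p) (mG L p) := by rw [RaF]; ring
  have hTb : ε * k * (PG L p.1 * mG L p + p.2 * (-(1 / 2) * mG L p ^ 3 *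
        (2 * AG L p * 0 + 32 * p.2 * PG L p.1))) =
      TbF ε k p.2 (mG L p) (PG L p.1) := by rw [TbF]; ring
  simp only [hRa, hTb]
  unfold EF GF
  generalize deriv Real.smoothTransition (2 - MG L p / i) = dχ at *
  generalize deriv Real.smoothTransition (i * AG L p - 1) = dκ at *
  generalize aF ε (AG L p) (mG L p) = a at *
  generalize bF ε k p.2 (mG L p) = b at *
  generalize RaF ε (AG L p) (mG L p) = Ra at *
  generalize TbF ε k p.2 (mG L p) (PG L p.1) = Tb at *
  generalize fderiv ℝ g p (p.1, 0) = g1 at *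
  generalize fderiv ℝ g p (Yv L p.1, PG L p.1) = g2 at *
  generalize kG L i p = κ at *
  generalize cG L i p = χ at *
  generalize rG L β V p = r at *
  generalize gradSqG L g p = G at *
  generalize V' (sG L β p) = v at *
  generalize AG L p ^ 2 / NG L p ^ 3 = n1 at *
  generalize 8 * p.2 * PG L p.1 / NG L p ^ 3 = n2 at *
  have t1 := mul_le_mul_of_nonneg_left hgrad (show 0 ≤ κ * χ * r by positivity)
  have t2 := mul_le_mul_of_nonneg_left hcut1 (show 0 ≤ g p ^ 2 * χ * r by positivity)
  have t3 := mul_le_mul_of_nonneg_left hcut2 (show 0 ≤ g p ^ 2 * κ * r by positivity)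
  have t4 : g p ^ 2 * κ * r * (8 * Cσ / √i) ≤ g p ^ 2 * 1 * r * (8 * Cσ / √i) := by gcongr
  have hdiv : ∀ X : ℝ, X / i = X * i⁻¹ := fun X => div_eq_mul_inv X i
  simp only [hdiv] at *
  simp only [zero_div, zero_mul, mul_zero, sub_zero, add_zero, zero_add] at *
  linarith

lemma ae_ne {n : ℕ} (hn : 2 ≤ n) : ∀ᵐ p : PtG n, p.1 ≠ 0 := by
  have : Nonempty (Fin (2 * n)) := ⟨⟨0, by omega⟩⟩
  have h : ∀ᵐ x : Fin (2 * n) → ℝ, x ≠ 0 := by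
    rw [ae_iff]; simp
  exact (Measure.quasiMeasurePreserving_fst (μ := (volume : Measure (Fin (2 * n) → ℝ)))
    (ν := (volume : Measure ℝ))).ae h

lemma continuousAt_DG {n : ℕ} (L : Fin n → ℝ) (d β ε k : ℝ) {V' : ℝ → ℝ} (hV : Continuous V')
    (p : PtG n) (hA : 0 < AG L p) (hq : 0 < qG p.1) :
    ContinuousAt (fun p : PtG n => V' (sG L β p) *
      EF ε k β (AG L p) p.2 (NG L p) (mG L p) (PG L p.1) -
        GF d ε k (AG L p) p.2 (mG L p) (PG L p.1) (qG p.1)) p := by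
  have h1 : ContinuousAt (AG L) p := (contDiff_AG L (m := 1)).continuous.continuousAt
  have h2 : ContinuousAt (NG L) p := (continuous_NG L).continuousAt
  have h3 : ContinuousAt (mG L) p := (contDiff_mG L (m := 1)).continuous.continuousAt
  have h4 : Continuous (PG L) := (contDiff_PG L (m := 1)).continuous
  have h5 : Continuous (qG (n := n)) := (contDiff_qG (m := 1)).continuous
  have h6 : ContinuousAt (sG L β) p := (contDiffAt_sG L β p hA hq (m := 1)).continuousAt
  have hz : ContinuousAt (fun p : PtG n => p.2) p := continuous_snd.continuousAt
  have hN : NG L p ^ 3 ≠ 0 := (pow_pos (NG_pos L p hA) 3).ne'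
  have hA1 : 1 + AG L p ≠ 0 := by positivity
  have hA2 : (1 + AG L p) ^ 2 ≠ 0 := by positivity
  unfold EF GF RaF TbF aF bF
  fun_prop (disch := assumption)

lemma continuousAt_rG {n : ℕ} {L : Fin n → ℝ} {l : ℝ} (hl : 0 < l)
    (hc : ∀ x, l * qG x ≤ 2 * SG L x) (β : ℝ) {V : ℝ → ℝ} (hV : ContDiff ℝ 1 V) (p : PtG n)
    (hp : p.1 ≠ 0) : ContinuousAt (rG L β V) p :=
  (contDiffAt_rG L β hV p (AG_pos hl p (hc _) hp) (qG_pos hp)).continuousAt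

lemma gradSqG_sub {n : ℕ} (L : Fin n → ℝ) (f : PtG n → ℝ) (c : ℝ) (p : PtG n) :
    gradSqG L (fun p => f p - c) p = gradSqG L f p := by
  unfold gradSqG XG; simp only [fderiv_sub_const]

lemma gradSqG_eq {n : ℕ} (L : Fin n → ℝ) (f : PtG n → ℝ) (p : PtG n) :
    gradSqG L f p = ∑ j, (fderiv ℝ f p (Pi.single j 1, 0) +
      Yv L p.1 j * fderiv ℝ f p (0, 1)) ^ 2 := rfl

lemma continuous_gradSqG {n : ℕ} (L : Fin n → ℝ) {f : PtG n → ℝ} (hf : ContDiff ℝ 1 f) :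
    Continuous (gradSqG L f) := by
  have h := hf.continuous_fderiv (by norm_num)
  have hY := continuous_Yv L
  have hY' : ∀ j, Continuous fun p : PtG n => Yv L p.1 j := fun j =>
    (hY j).comp continuous_fst
  have : gradSqG L f = fun p => ∑ j, (fderiv ℝ f p (Pi.single j 1, 0) +
      Yv L p.1 j * fderiv ℝ f p (0, 1)) ^ 2 := rfl
  rw [this]
  fun_prop

lemma hcs_gradSqG {n : ℕ} (L : Fin n → ℝ) {f : PtG n → ℝ} (hs : HasCompactSupport f) :
    HasCompactSupport (gradSqG L f) := by
  refine HasCompactSupport.intro hs fun p hp => ?_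
  have : fderiv ℝ f p = 0 := by
    by_contra hne
    exact hp (support_fderiv_subset ℝ hne)
  rw [gradSqG_eq, this]; simp

lemma int_mul_r {n : ℕ} {h r : PtG n → ℝ} (hr : Integrable r) (hc : Continuous h)
    (hs : HasCompactSupport h) : Integrable fun p => h p * r p := by
  obtain ⟨C, hC⟩ := hs.exists_bound_of_continuous hc
  exact hr.bdd_mul hc.aestronglyMeasurable (c := C) (Eventually.of_forall hC)

lemma int_sq_r {n : ℕ} {f r : PtG n → ℝ} (hr : Integrable r) (hc : Continuous f)
    (hs : HasCompactSupport f) (c : ℝ) : Integrable fun p => (f p - c) ^ 2 * r p := by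
  obtain ⟨C, hC⟩ := hs.exists_bound_of_continuous hc
  refine hr.bdd_mul (c := (C + |c|) ^ 2) (by fun_prop) (Eventually.of_forall fun p => ?_)
  rw [norm_pow]
  gcongr
  exact (norm_sub_le _ _).trans (add_le_add (hC p) le_rfl)

lemma int_combine {α : Type*} [MeasurableSpace α] {μ : Measure α} {a b c d e f g : α → ℝ}
    {A B C D : ℝ} (ha : Integrable a μ) (hb : Integrable b μ) (hc : Integrable c μ)
    (hd : Integrable d μ) (he : Integrable e μ) (hf : Integrable f μ) (hg : Integrable g μ)
    (h : ∀ᵐ p ∂μ, a p + A * b p + c p ≤ d p + B * e p + C * f p - D * g p) :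
    (∫ p, a p ∂μ) + A * (∫ p, b p ∂μ) + (∫ p, c p ∂μ) ≤
      (∫ p, d p ∂μ) + B * (∫ p, e p ∂μ) + C * (∫ p, f p ∂μ) - D * (∫ p, g p ∂μ) := by
  have h1 : Integrable (fun p => a p + A * b p) μ := ha.add (hb.const_mul A)
  have h2 : Integrable (fun p => a p + A * b p + c p) μ := h1.add hc
  have h3 : Integrable (fun p => d p + B * e p) μ := hd.add (he.const_mul B)
  have h4 : Integrable (fun p => d p + B * e p + C * f p) μ := h3.add (hf.const_mul C)
  have h5 : Integrable (fun p => d p + B * e p + C * f p - D * g p) μ := h4.sub (hg.const_mul D)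
  have := integral_mono_ae h2 h5 h
  rwa [integral_add h1 hc, integral_add ha (hb.const_mul A), integral_sub h4 (hg.const_mul D),
    integral_add h3 (hf.const_mul C), integral_add hd (he.const_mul B),
    integral_const_mul, integral_const_mul, integral_const_mul, integral_const_mul] at this

/-- integrated form with cutoffs -/
lemma ubound_cut {n : ℕ} {L : Fin n → ℝ} {l β ε k i A₀ Cσ C0 : ℝ} {V V' : ℝ → ℝ}
    (hn : 2 ≤ n) (hl : 0 < l) (hc : ∀ x, l * qG x ≤ 2 * SG L x)
    (hV' : ∀ s : ℝ, HasDerivAt V (V' s) s) (hV : ContDiff ℝ 1 V)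
    (hr : Integrable (rG L β V)) {K : Set (PtG n)} (hK : MeasurableSet K) (hC0 : 0 ≤ C0)
    (hi : 0 < i) (hiA : 2 / i ≤ A₀)
    (hCσ : ∀ t, deriv Real.smoothTransition t ≤ Cσ) (hCσ0 : 0 < Cσ)
    (ha : ∀ p, p.1 ≠ 0 → AG L p ≤ A₀ → aF ε (AG L p) (mG L p) ≤ 0)
    (hM : ∀ p, p.1 ≠ 0 → - (4 * AG L p) ≤ aF ε (AG L p) (mG L p) * (4 * AG L p ^ 2) +
      bF ε k p.2 (mG L p) * (32 * p.2 * PG L p.1))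
    (hD1 : ∀ p ∉ K, p.1 ≠ 0 → 1 / 2 ≤ V' (sG L β p) *
        EF ε k β (AG L p) p.2 (NG L p) (mG L p) (PG L p.1) -
        GF (2 * n) ε k (AG L p) p.2 (mG L p) (PG L p.1) (qG p.1))
    (hD2 : ∀ p ∈ K, - C0 ≤ V' (sG L β p) *
        EF ε k β (AG L p) p.2 (NG L p) (mG L p) (PG L p.1) -
        GF (2 * n) ε k (AG L p) p.2 (mG L p) (PG L p.1) (qG p.1))
    {f : PtG n → ℝ} (hf : ContDiff ℝ 1 f) (hs : HasCompactSupport f) (c : ℝ) :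
    1 / 2 * ∫ p, kG L i p * cG L i p * ((f p - c) ^ 2 * rG L β V p) ≤
      (∫ p, gradSqG L f p * rG L β V p) +
      (C0 + 1 / 2) * (∫ p in K, (f p - c) ^ 2 * rG L β V p) +
      (8 * Cσ / √i) * ∫ p, (f p - c) ^ 2 * rG L β V p := by
  set g : PtG n → ℝ := fun p => f p - c with hgdef
  have hg : ContDiff ℝ 1 g := hf.sub contDiff_const
  have hkcr := contDiff_kcr hl hc β hV i
  have hkcs := hcs_kcr hl hc β (V := V) hi
  have hF1 : ContDiff ℝ 1 (fun p => g p ^ 2 * aF ε (AG L p) (mG L p) *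
      (kG L i p * cG L i p * rG L β V p)) := ((hg.pow 2).mul (contDiff_a L ε)).mul hkcr
  have hF2 : ContDiff ℝ 1 (fun p => g p ^ 2 * bF ε k p.2 (mG L p) *
      (kG L i p * cG L i p * rG L β V p)) := ((hg.pow 2).mul (contDiff_b L ε k)).mul hkcr
  have hs1 : HasCompactSupport (fun p => g p ^ 2 * aF ε (AG L p) (mG L p) *
      (kG L i p * cG L i p * rG L β V p)) := hkcs.mul_left
  have hs2 : HasCompactSupport (fun p => g p ^ 2 * bF ε k p.2 (mG L p) *
      (kG L i p * cG L i p * rG L β V p)) := hkcs.mul_left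
  obtain ⟨i1, e1⟩ := ibp_R hF1 hs1
  obtain ⟨i2, e2⟩ := ibp_T L hF2 hs2
  have i3 := hF1.continuous.integrable_of_hasCompactSupport (μ := volume) hs1
  have hG := int_mul_r hr (continuous_gradSqG L hf) (hcs_gradSqG L hs)
  have hh := int_sq_r hr hf.continuous hs c
  have hkc : Integrable fun p => kG L i p * cG L i p * ((f p - c) ^ 2 * rG L β V p) := by
    refine hh.bdd_mul (c := 1) ?_ (Eventually.of_forall fun p => ?_)
    · exact ((contDiff_kG L i).continuous.mul (contDiff_cG L i).continuous).aestronglyMeasurable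
    · have h0 : 0 ≤ kG L i p * cG L i p := mul_nonneg (Real.smoothTransition.nonneg _)
        (Real.smoothTransition.nonneg _)
      rw [Real.norm_eq_abs, abs_of_nonneg h0]
      exact mul_le_one₀ (Real.smoothTransition.le_one _) (Real.smoothTransition.nonneg _)
        (Real.smoothTransition.le_one _)
  have key : ∀ᵐ p : PtG n, (fderiv ℝ (fun p => g p ^ 2 * aF ε (AG L p) (mG L p) *
      (kG L i p * cG L i p * rG L β V p)) p (p.1, 0) +
    (2 * n) * (g p ^ 2 * aF ε (AG L p) (mG L p) * (kG L i p * cG L i p * rG L β V p))) +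
    fderiv ℝ (fun p => g p ^ 2 * bF ε k p.2 (mG L p) *
      (kG L i p * cG L i p * rG L β V p)) p (Yv L p.1, PG L p.1) ≤
      ((gradSqG L f p * rG L β V p +
        (C0 + 1 / 2) * K.indicator (fun p => (f p - c) ^ 2 * rG L β V p) p) +
        (8 * Cσ / √i) * ((f p - c) ^ 2 * rG L β V p)) -
        1 / 2 * (kG L i p * cG L i p * ((f p - c) ^ 2 * rG L β V p)) := by
    filter_upwards [ae_ne hn] with p hp
    have hpt := pointwise (g := g) (β := β) hV' (AG_pos hl p (hc _) hp) (qG_pos hp) hi hiA hCσ hCσ0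
      (hg.differentiable (by norm_num) p) (hF1.differentiable (by norm_num) p)
      (hF2.differentiable (by norm_num) p) (ha p hp) (hM p hp)
    refine hpt.trans ?_
    rw [show gradSqG L g p = gradSqG L f p from gradSqG_sub L f c p]
    have hk0 : 0 ≤ kG L i p := Real.smoothTransition.nonneg _
    have hk1 : kG L i p ≤ 1 := Real.smoothTransition.le_one _
    have hc0 : 0 ≤ cG L i p := Real.smoothTransition.nonneg _
    have hc1 : cG L i p ≤ 1 := Real.smoothTransition.le_one _
    have hr0 : 0 ≤ rG L β V p := (Real.exp_pos _).le
    have hG0 : 0 ≤ gradSqG L f p := by unfold gradSqG; positivity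
    have hkc0 : 0 ≤ kG L i p * cG L i p := by positivity
    have hkc1 : kG L i p * cG L i p ≤ 1 := mul_le_one₀ hk1 hc0 hc1
    have hgp : g p = f p - c := rfl
    rw [hgp]
    have hsq : 0 ≤ (f p - c) ^ 2 := sq_nonneg _
    by_cases hpK : p ∈ K
    · rw [Set.indicator_of_mem hpK]
      have hD := hD2 p hpK
      generalize V' (sG L β p) * EF ε k β (AG L p) p.2 (NG L p) (mG L p) (PG L p.1) -
        GF (2 * n) ε k (AG L p) p.2 (mG L p) (PG L p.1) (qG p.1) = D at *
      generalize kG L i p * cG L i p = κ at *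
      generalize (f p - c) ^ 2 = h at *
      generalize rG L β V p = r at *
      generalize gradSqG L f p = G at *
      have t1 := mul_le_mul_of_nonneg_right hkc1 (mul_nonneg hG0 hr0)
      have t2 := mul_le_mul_of_nonneg_left hD (show 0 ≤ κ * h * r by positivity)
      have t3 := mul_le_mul_of_nonneg_right hkc1 (show 0 ≤ (C0 + 1 / 2) * (h * r) by positivity)
      linarith
    · rw [Set.indicator_of_notMem hpK]
      have hD := hD1 p hpK hp
      generalize V' (sG L β p) * EF ε k β (AG L p) p.2 (NG L p) (mG L p) (PG L p.1) -
        GF (2 * n) ε k (AG L p) p.2 (mG L p) (PG L p.1) (qG p.1) = D at *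
      generalize kG L i p * cG L i p = κ at *
      generalize (f p - c) ^ 2 = h at *
      generalize rG L β V p = r at *
      generalize gradSqG L f p = G at *
      have t1 := mul_le_mul_of_nonneg_right hkc1 (mul_nonneg hG0 hr0)
      have t2 := mul_le_mul_of_nonneg_left hD (show 0 ≤ κ * h * r by positivity)
      linarith
  have hIntg := int_combine i1 i3 i2 hG (hh.indicator hK) hh hkc key
  rw [e1, e2, integral_indicator hK] at hIntg
  linarith

lemma ubound {n : ℕ} (hn : 2 ≤ n) {L : Fin n → ℝ} (hL : ∀ j, L j ≠ 0) {β : ℝ} (hβ : 0 < β)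
    {V V' : ℝ → ℝ} (hV' : ∀ s : ℝ, HasDerivAt V (V' s) s) (hVc : Continuous V')
    (hVmono : Monotone V) (hgrow : Tendsto (fun s => V' s / s ^ 2) atTop atTop)
    (hr : Integrable (rG L β V)) :
    ∃ (K : Set (PtG n)) (C : ℝ), IsCompact K ∧ (∀ p ∈ K, p.1 ≠ 0) ∧ 0 ≤ C ∧
    ∀ f : PtG n → ℝ, ContDiff ℝ 1 f → HasCompactSupport f → ∀ c : ℝ,
      ∫ p, (f p - c) ^ 2 * rG L β V p ≤ 2 * (∫ p, gradSqG L f p * rG L β V p) +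
        C * ∫ p in K, (f p - c) ^ 2 * rG L β V p := by
  obtain ⟨l, l', hl, hl', hc⟩ := exists_consts hn L hL
  have hc3 : ∀ x, l * qG x ≤ 2 * SG L x := fun x => (hc x).2.2
  have hV : ContDiff ℝ 1 V := by
    rw [contDiff_one_iff_deriv]
    refine ⟨fun s => (hV' s).differentiableAt, ?_⟩
    rwa [show deriv V = V' from funext fun s => (hV' s).deriv]
  have hV0 : ∀ s, 0 ≤ V' s := fun s => by
    rw [← (hV' s).deriv]; exact hVmono.deriv_nonneg
  have hd : (4:ℝ) ≤ 2 * n := by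
    have : (2:ℝ) ≤ n := by exact_mod_cast hn
    linarith
  obtain ⟨ε, k, A₀, Q, N₁, hε, hk, hA₀, hQ, hN₁, hly⟩ := lyap (2 * n) β l l' hd hβ hl hl'
  obtain ⟨N₂, hN₂⟩ := growth (Q := Q) hβ hl hgrow
  obtain ⟨Cσ, hCσ0, hCσ⟩ := st_deriv_bdd
  have hly' := fun (p : PtG n) (hp : p.1 ≠ 0) =>
    hly (AG L p) p.2 (NG L p) (mG L p) (PG L p.1) (qG p.1) (AG_pos hl p (hc3 _) hp)
      (NG_pos L p (AG_pos hl p (hc3 _) hp)) (mG_pos L p) (NG_pow L p) (mG_sq L p) (hc p.1).1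
      (hc p.1).2.1 (qG_nonneg _) (hc3 _)
  set K : Set (PtG n) := {p | A₀ ≤ AG L p ∧ NG L p ≤ max N₁ N₂} with hKdef
  have hKclosed : IsClosed K :=
    (isClosed_le continuous_const (contDiff_AG L (m := 1)).continuous).inter
      (isClosed_le (continuous_NG L) continuous_const)
  have hKc : IsCompact K := by
    refine (compact_MG hl hc3 (1 + (max N₁ N₂) ^ 4)).of_isClosed_subset hKclosed fun p hp => ?_
    change MG L p ≤ _
    rw [MG, ← NG_pow]
    have := NG_nonneg L p
    have := hp.2
    gcongr
  have hKne : ∀ p ∈ K, p.1 ≠ 0 := fun p hp h0 => by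
    have := hp.1
    rw [AG_zero L p h0] at this
    linarith
  obtain ⟨C0, hC0⟩ := hKc.exists_bound_of_continuousOn (f := fun p : PtG n => V' (sG L β p) *
      EF ε k β (AG L p) p.2 (NG L p) (mG L p) (PG L p.1) -
        GF (2 * n) ε k (AG L p) p.2 (mG L p) (PG L p.1) (qG p.1)) (fun p hp =>
      (continuousAt_DG L _ β ε k hVc p (AG_pos hl p (hc3 _) (hKne p hp))
        (qG_pos (hKne p hp))).continuousWithinAt)
  have hD2 : ∀ p ∈ K, - (max C0 0) ≤ V' (sG L β p) *
        EF ε k β (AG L p) p.2 (NG L p) (mG L p) (PG L p.1) -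
        GF (2 * n) ε k (AG L p) p.2 (mG L p) (PG L p.1) (qG p.1) := fun p hp =>
    (neg_le_neg (le_max_left C0 0)).trans (abs_le.1 (hC0 p hp)).1
  have hD1 : ∀ p ∉ K, p.1 ≠ 0 → 1 / 2 ≤ V' (sG L β p) *
        EF ε k β (AG L p) p.2 (NG L p) (mG L p) (PG L p.1) -
        GF (2 * n) ε k (AG L p) p.2 (mG L p) (PG L p.1) (qG p.1) := fun p hpK hp => by
    obtain ⟨h1, h2, -, -⟩ := hly' p hp
    rcases le_total (AG L p) A₀ with h | h
    · exact h1 _ (hV0 _) h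
    · have hN : max N₁ N₂ < NG L p := by
        by_contra hcon
        exact hpK ⟨h, not_lt.1 hcon⟩
      have hN1 := (le_max_left N₁ N₂).trans hN.le
      have hN2 := (le_max_right N₁ N₂).trans hN.le
      refine h2 _ h hN1 (hN₂ _ _ hN2 (qG_pos hp) ((hc3 _).trans ?_))
      have h3 : AG L p ^ 2 ≤ (NG L p ^ 2) ^ 2 := by
        rw [← pow_mul, NG_pow]; nlinarith [sq_nonneg p.2]
      exact (abs_le_of_sq_le_sq' h3 (by positivity)).2
  refine ⟨K, 2 * (max C0 0 + 1 / 2), hKc, hKne, by positivity, fun f hf hs c => ?_⟩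
  have hh := int_sq_r hr hf.continuous hs c
  have hcut : ∀ᶠ i : ℕ in atTop, 1 / 2 * ∫ p, kG L i p * cG L i p * ((f p - c) ^ 2 * rG L β V p) ≤
      (∫ p, gradSqG L f p * rG L β V p) +
      (max C0 0 + 1 / 2) * (∫ p in K, (f p - c) ^ 2 * rG L β V p) +
      (8 * Cσ / √(i:ℝ)) * ∫ p, (f p - c) ^ 2 * rG L β V p := by
    have h1 : Tendsto (fun i : ℕ => 2 / (i:ℝ)) atTop (nhds 0) :=
      tendsto_const_div_atTop_nhds_zero_nat 2
    filter_upwards [h1.eventually_le_const hA₀, eventually_gt_atTop 0] with i hi1 hi0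
    exact ubound_cut hn hl hc3 hV' hV hr hKclosed.measurableSet (le_max_right _ _)
      (by exact_mod_cast hi0) hi1 hCσ hCσ0 (fun p hp => (hly' p hp).2.2.1)
      (fun p hp => (hly' p hp).2.2.2) hD1 hD2 hf hs c
  have hlim1 : Tendsto (fun i : ℕ => ∫ p, kG L i p * cG L i p * ((f p - c) ^ 2 * rG L β V p)) atTop
      (nhds (∫ p, (f p - c) ^ 2 * rG L β V p)) := by
    refine tendsto_integral_of_dominated_convergence
      (fun p => (f p - c) ^ 2 * rG L β V p) (fun i => ?_) hh (fun i => ?_) ?_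
    · exact (((contDiff_kG L i).continuous.mul
        (contDiff_cG L i).continuous).aestronglyMeasurable).mul hh.aestronglyMeasurable
    · refine Eventually.of_forall fun p => ?_
      have hr0 : 0 ≤ rG L β V p := (Real.exp_pos _).le
      have hk0 : 0 ≤ kG L i p := Real.smoothTransition.nonneg _
      have hc0 : 0 ≤ cG L i p := Real.smoothTransition.nonneg _
      rw [Real.norm_eq_abs, abs_of_nonneg (by positivity)]
      exact mul_le_of_le_one_left (by positivity) (mul_le_one₀ (Real.smoothTransition.le_one _) hc0
        (Real.smoothTransition.le_one _))
    · filter_upwards [ae_ne hn] with p hp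
      have hA := AG_pos hl p (hc3 _) hp
      refine tendsto_const_nhds.congr' ?_
      have t1 : Tendsto (fun i : ℕ => (i:ℝ) * AG L p) atTop atTop :=
        tendsto_natCast_atTop_atTop.atTop_mul_const hA
      have t2 : Tendsto (fun i : ℕ => MG L p / (i:ℝ)) atTop (nhds 0) :=
        tendsto_const_div_atTop_nhds_zero_nat _
      filter_upwards [t1.eventually_ge_atTop 2, t2.eventually_le_const one_pos] with i h1 h2
      have e1 : kG L i p = 1 := Real.smoothTransition.one_of_one_le (by linarith)
      have e2 : cG L i p = 1 := Real.smoothTransition.one_of_one_le (by linarith)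
      rw [e1, e2]; ring
  have hlim2 : Tendsto (fun i : ℕ => 8 * Cσ / √(i:ℝ)) atTop (nhds 0) :=
    Tendsto.div_atTop tendsto_const_nhds
      (Real.tendsto_sqrt_atTop.comp tendsto_natCast_atTop_atTop)
  have := le_of_tendsto_of_tendsto (hlim1.const_mul (1 / 2))
    (tendsto_const_nhds.add (hlim2.mul_const _)) hcut
  linarith

lemma line_sq {F F' : ℝ → ℝ} (hF : ∀ t, HasDerivAt F (F' t) t) (hc : Continuous F') :
    ENNReal.ofReal ((F 1 - F 0) ^ 2) ≤ ∫⁻ t in Set.Ioc (0:ℝ) 1, ENNReal.ofReal (F' t ^ 2) := by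
  have e : ∫ t in (0:ℝ)..1, F' t = F 1 - F 0 :=
    intervalIntegral.integral_eq_sub_of_hasDerivAt (fun t _ => hF t) (hc.intervalIntegrable _ _)
  set m := F 1 - F 0 with hm
  have h0 : 0 ≤ ∫ t in (0:ℝ)..1, (F' t - m) ^ 2 :=
    intervalIntegral.integral_nonneg zero_le_one fun t _ => sq_nonneg _
  have h1 : ∫ t in (0:ℝ)..1, (F' t - m) ^ 2 =
      (∫ t in (0:ℝ)..1, F' t ^ 2) - (2 * m) * (∫ t in (0:ℝ)..1, F' t) + m ^ 2 := by
    have e1 : ∀ t, (F' t - m) ^ 2 = F' t ^ 2 - (2 * m) * F' t + m ^ 2 := fun t => by ring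
    simp only [e1]
    rw [intervalIntegral.integral_add, intervalIntegral.integral_sub,
      intervalIntegral.integral_const_mul]
    · simp
    all_goals exact Continuous.intervalIntegrable (by fun_prop) _ _
  rw [e] at h1
  have h2 : m ^ 2 ≤ ∫ t in (0:ℝ)..1, F' t ^ 2 := by nlinarith
  rw [intervalIntegral.integral_of_le zero_le_one] at h2
  refine (ENNReal.ofReal_le_ofReal h2).trans (le_of_eq ?_)
  refine ofReal_integral_eq_lintegral_ofReal ?_ (Eventually.of_forall fun t => sq_nonneg _)
  exact (Continuous.integrableOn_Icc (by fun_prop)).mono_set Set.Ioc_subset_Icc_self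

/-- right translations -/
noncomputable def Tr {n : ℕ} (L : Fin n → ℝ) (v : Fin (2 * n) → ℝ) (p : PtG n) : PtG n :=
  (p.1 + v, p.2 + om L v p.1)

lemma continuous_om {n : ℕ} (L : Fin n → ℝ) :
    Continuous fun q : (Fin (2 * n) → ℝ) × (Fin (2 * n) → ℝ) => om L q.1 q.2 := by
  have h : ∀ j, Continuous fun q : (Fin (2 * n) → ℝ) × (Fin (2 * n) → ℝ) => Yv L q.2 j :=
    fun j => (continuous_Yv L j).comp continuous_snd
  unfold om
  fun_prop

lemma continuous_Tr {n : ℕ} (L : Fin n → ℝ) :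
    Continuous fun q : (Fin (2 * n) → ℝ) × PtG n => Tr L q.1 q.2 := by
  have := continuous_om L
  have h : Continuous fun q : (Fin (2 * n) → ℝ) × PtG n => om L q.1 q.2.1 :=
    this.comp (f := fun q : (Fin (2 * n) → ℝ) × PtG n => (q.1, q.2.1)) (by fun_prop)
  unfold Tr
  fun_prop

lemma mp_shear {n : ℕ} (v : Fin (2 * n) → ℝ) {g : (Fin (2 * n) → ℝ) → ℝ} (hg : Continuous g) :
    MeasurePreserving (fun p : PtG n => ((p.1 + v, p.2 + g p.1) : PtG n)) := by
  refine MeasurePreserving.skew_product (μa := (volume : Measure (Fin (2 * n) → ℝ)))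
    (μb := (volume : Measure (Fin (2 * n) → ℝ))) (μc := (volume : Measure ℝ))
    (μd := (volume : Measure ℝ)) (f := fun x => x + v)
    (g := fun x z => z + g x) (measurePreserving_add_right _ v) ?_ ?_
  · exact Continuous.measurable (by unfold Function.uncurry; fun_prop)
  · exact Eventually.of_forall fun x => (measurePreserving_add_right _ (g x)).map_eq

lemma mp_Tr {n : ℕ} (L : Fin n → ℝ) (v : Fin (2 * n) → ℝ) : MeasurePreserving (Tr L v) :=
  mp_shear v (g := fun x => om L v x)
    ((continuous_om L).comp (f := fun x => (v, x)) (by fun_prop))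

/-- the energy -/
noncomputable def DG {n : ℕ} (L : Fin n → ℝ) (r f : PtG n → ℝ) : ENNReal :=
  ∫⁻ p, ENNReal.ofReal (gradSqG L f p) * ENNReal.ofReal (r p)

/-- families of maps along which smooth functions vary little -/
def Good {n : ℕ} (L : Fin n → ℝ) (r : PtG n → ℝ) (Φ : PtG n → PtG n → PtG n) : Prop :=
  Continuous (Function.uncurry Φ) ∧ (∀ p, Φ 0 p = p) ∧ (∀ h, MeasurePreserving (Φ h)) ∧
  ∀ p0 : PtG n, p0.1 ≠ 0 → ∃ U O : Set (PtG n), IsOpen U ∧ p0 ∈ U ∧ IsOpen O ∧ 0 ∈ O ∧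
    ∃ C : ENNReal, C ≠ ⊤ ∧ ∀ h ∈ O, ∀ f : PtG n → ℝ, ContDiff ℝ 1 f →
      ∫⁻ p in U, ENNReal.ofReal ((f (Φ h p) - f p) ^ 2) ≤ C * DG L r f

lemma Tr_flow {n : ℕ} (L : Fin n → ℝ) (v : Fin (2 * n) → ℝ) (p : PtG n) {f : PtG n → ℝ}
    (hf : ContDiff ℝ 1 f) (t : ℝ) :
    HasDerivAt (fun t : ℝ => f (Tr L (t • v) p))
      (fderiv ℝ f (Tr L (t • v) p) (v, om L v (Tr L (t • v) p).1)) t := by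
  have h1 : HasDerivAt (fun t : ℝ => Tr L (t • v) p) (v, om L v (Tr L (t • v) p).1) t := by
    have e : om L v (Tr L (t • v) p).1 = om L v p.1 := by
      simp [Tr, om_add_right, om_smul_right, om_self]
    rw [e]
    have e2 : (fun t : ℝ => Tr L (t • v) p) = fun t : ℝ => p + t • ((v, om L v p.1) : PtG n) := by
      ext t : 1
      ext1
      · simp [Tr]
      · simp [Tr, om_smul_left]
    rw [e2]
    have := ((hasDerivAt_id t).smul_const ((v, om L v p.1) : PtG n)).const_add p
    simpa using this
  exact ((hf.differentiable (by norm_num) _).hasFDerivAt).comp_hasDerivAt t h1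

lemma Tr_diff {n : ℕ} (L : Fin n → ℝ) (v : Fin (2 * n) → ℝ) (p : PtG n) {f : PtG n → ℝ}
    (hf : ContDiff ℝ 1 f) (hv : qG v ≤ 1) :
    ENNReal.ofReal ((f (Tr L v p) - f p) ^ 2) ≤
      ∫⁻ t in Set.Ioc (0:ℝ) 1, ENNReal.ofReal (gradSqG L f (Tr L (t • v) p)) := by
  have hT : Continuous fun t : ℝ => Tr L (t • v) p :=
    (continuous_Tr L).comp (f := fun t : ℝ => (t • v, p)) (by fun_prop)
  have hom : Continuous fun t : ℝ => om L v (Tr L (t • v) p).1 :=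
    (continuous_om L).comp (f := fun t : ℝ => (v, (Tr L (t • v) p).1)) (by fun_prop)
  have hfd := hf.continuous_fderiv (by norm_num)
  have h := line_sq (Tr_flow L v p hf) (by fun_prop)
  have e1 : Tr L ((1:ℝ) • v) p = Tr L v p := by rw [one_smul]
  have e0 : Tr L ((0:ℝ) • v) p = p := by
    ext1
    · simp [Tr]
    · simp [Tr, om]
  rw [e1, e0] at h
  refine h.trans (lintegral_mono fun t => ENNReal.ofReal_le_ofReal ?_)
  refine (horizontal_sq_le L f _ v).trans ?_
  have : 0 ≤ gradSqG L f (Tr L (t • v) p) := by unfold gradSqG; positivity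
  nlinarith

lemma good_base {n : ℕ} (L : Fin n → ℝ) {r : PtG n → ℝ} (hr0 : ∀ p, 0 < r p)
    (hrc : ∀ p : PtG n, p.1 ≠ 0 → ContinuousAt r p) {v : PtG n → Fin (2 * n) → ℝ}
    (hv : Continuous v) (hv0 : v 0 = 0) : Good L r fun h p => Tr L (v h) p := by
  refine ⟨?_, ?_, fun h => mp_Tr L _, fun p0 hp0 => ?_⟩
  · exact (continuous_Tr L).comp (f := fun q : PtG n × PtG n => (v q.1, q.2)) (by fun_prop)
  · intro p
    ext1
    · simp [Tr, hv0]
    · simp [Tr, hv0, om]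
  have hS : IsOpen {p : PtG n | p.1 ≠ 0} := isOpen_ne_fun continuous_fst continuous_const
  obtain ⟨B, hBc, hpB, hBS⟩ := exists_compact_subset hS hp0
  obtain ⟨C1, hC1⟩ := hBc.exists_bound_of_continuousOn (f := fun p => (r p)⁻¹) (fun p hp =>
    ((hrc p (hBS hp)).inv₀ (hr0 p).ne').continuousWithinAt)
  have hTc : Continuous fun q : (PtG n × PtG n) × ℝ => Tr L (q.2 • v q.1.1) q.1.2 :=
    (continuous_Tr L).comp (f := fun q : (PtG n × PtG n) × ℝ => (q.2 • v q.1.1, q.1.2))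
      (by fun_prop)
  have hev : ∀ᶠ q : PtG n × PtG n in nhds (0, p0), ∀ t ∈ Set.Icc (0:ℝ) 1,
      Tr L (t • v q.1) q.2 ∈ interior B := by
    refine isCompact_Icc.eventually_forall_of_forall_eventually fun t _ => ?_
    refine hTc.continuousAt.eventually_mem (isOpen_interior.mem_nhds ?_)
    have : Tr L (t • v 0) p0 = p0 := by
      ext1
      · simp [Tr, hv0]
      · simp [Tr, hv0, om]
    simpa [this] using hpB
  have hq : ∀ᶠ q : PtG n × PtG n in nhds (0, p0), qG (v q.1) < 1 := by
    have hqc : Continuous (qG (n := n)) := (contDiff_qG (m := 1)).continuous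
    have : ContinuousAt (fun q : PtG n × PtG n => qG (v q.1)) (0, p0) :=
      Continuous.continuousAt (by fun_prop)
    refine this.eventually_lt_const ?_
    simp [hv0, qG]
  obtain ⟨O, U, hO, h0O, hU, hpU, hOU⟩ := mem_nhds_prod_iff'.1 (hev.and hq)
  refine ⟨U, O, hU, hpU, hO, h0O, ENNReal.ofReal C1, ENNReal.ofReal_ne_top, fun h hh f hf => ?_⟩
  have hg := continuous_gradSqG L hf
  have hTh : Continuous fun q : PtG n × ℝ => Tr L (q.2 • v h) q.1 :=
    hTc.comp (f := fun q : PtG n × ℝ => ((h, q.1), q.2)) (by fun_prop)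
  by_cases hne : U.Nonempty
  swap
  · rw [Set.not_nonempty_iff_eq_empty.1 hne]; simp
  obtain ⟨p1, hp1⟩ := hne
  have hvh : qG (v h) ≤ 1 := (hOU (Set.mk_mem_prod hh hp1)).2.le
  calc ∫⁻ p in U, ENNReal.ofReal ((f (Tr L (v h) p) - f p) ^ 2)
      ≤ ∫⁻ p in U, ∫⁻ t in Set.Ioc (0:ℝ) 1, ENNReal.ofReal (gradSqG L f (Tr L (t • v h) p)) :=
        lintegral_mono fun p => Tr_diff L (v h) p hf hvh
    _ = ∫⁻ t in Set.Ioc (0:ℝ) 1, ∫⁻ p in U, ENNReal.ofReal (gradSqG L f (Tr L (t • v h) p)) := by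
        refine lintegral_lintegral_swap (Measurable.aemeasurable ?_)
        refine ENNReal.measurable_ofReal.comp (Continuous.measurable ?_)
        exact hg.comp hTh
    _ ≤ ∫⁻ t in Set.Ioc (0:ℝ) 1, ENNReal.ofReal C1 * DG L r f := by
        refine setLIntegral_mono measurable_const fun t ht => ?_
        calc ∫⁻ p in U, ENNReal.ofReal (gradSqG L f (Tr L (t • v h) p))
            ≤ ∫⁻ p in Tr L (t • v h) ⁻¹' (interior B),
                ENNReal.ofReal (gradSqG L f (Tr L (t • v h) p)) := by
              refine lintegral_mono_set fun p hp => ?_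
              exact (hOU (Set.mk_mem_prod hh hp)).1 t ⟨ht.1.le, ht.2⟩
          _ = ∫⁻ p in interior B, ENNReal.ofReal (gradSqG L f p) :=
              (mp_Tr L _).setLIntegral_comp_preimage isOpen_interior.measurableSet
                (ENNReal.measurable_ofReal.comp hg.measurable)
          _ ≤ ∫⁻ p in interior B, ENNReal.ofReal C1 *
                (ENNReal.ofReal (gradSqG L f p) * ENNReal.ofReal (r p)) := by
              refine setLIntegral_mono' isOpen_interior.measurableSet fun p hp => ?_
              have hpB := hC1 p (interior_subset hp)
              have hrp := hr0 p
              rw [Real.norm_eq_abs, abs_of_pos (inv_pos.2 hrp)] at hpB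
              have hg0 : 0 ≤ gradSqG L f p := by unfold gradSqG; positivity
              have hC10 : 0 ≤ C1 := (inv_pos.2 hrp).le.trans hpB
              rw [← ENNReal.ofReal_mul hg0, ← ENNReal.ofReal_mul hC10]
              refine ENNReal.ofReal_le_ofReal ?_
              calc gradSqG L f p = (r p)⁻¹ * (gradSqG L f p * r p) := by field_simp
                _ ≤ _ := by gcongr
          _ = ENNReal.ofReal C1 * ∫⁻ p in interior B,
                (ENNReal.ofReal (gradSqG L f p) * ENNReal.ofReal (r p)) :=
              lintegral_const_mul' _ _ ENNReal.ofReal_ne_top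
          _ ≤ _ := by
              unfold DG
              gcongr
              exact Measure.restrict_le_self
    _ = _ := by simp

lemma sq_add_le_ofReal (a b c : ℝ) : ENNReal.ofReal ((a - c) ^ 2) ≤
    2 * ENNReal.ofReal ((a - b) ^ 2) + 2 * ENNReal.ofReal ((b - c) ^ 2) := by
  have h2 : (2 : ENNReal) = ENNReal.ofReal 2 := by simp
  rw [h2, ← ENNReal.ofReal_mul (by norm_num), ← ENNReal.ofReal_mul (by norm_num),
    ← ENNReal.ofReal_add (by positivity) (by positivity)]
  refine ENNReal.ofReal_le_ofReal ?_
  nlinarith [sq_nonneg ((a - b) - (b - c))]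

lemma good_comp {n : ℕ} {L : Fin n → ℝ} {r : PtG n → ℝ} {Φ Ψ : PtG n → PtG n → PtG n}
    (h1 : Good L r Φ) (h2 : Good L r Ψ) : Good L r fun h p => Φ h (Ψ h p) := by
  obtain ⟨c1, z1, m1, g1⟩ := h1
  obtain ⟨c2, z2, m2, g2⟩ := h2
  refine ⟨?_, fun p => by simp [z1, z2], fun h => (m1 h).comp (m2 h), fun p0 hp0 => ?_⟩
  · exact c1.comp (f := fun q : PtG n × PtG n => (q.1, Ψ q.1 q.2)) (continuous_fst.prodMk c2)
  obtain ⟨U1, O1, hU1, hp1, hO1, h01, C1, hC1, H1⟩ := g1 p0 hp0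
  obtain ⟨U2, O2, hU2, hp2, hO2, h02, C2, hC2, H2⟩ := g2 p0 hp0
  have hev : ∀ᶠ q : PtG n × PtG n in nhds (0, p0), Ψ q.1 q.2 ∈ U1 :=
    c2.continuousAt.eventually_mem (hU1.mem_nhds (by simpa [Function.uncurry, z2] using hp1))
  obtain ⟨O3, U3, hO3, h03, hU3, hp3, hOU⟩ := mem_nhds_prod_iff'.1 hev
  refine ⟨U2 ∩ U3, O1 ∩ O2 ∩ O3, hU2.inter hU3, ⟨hp2, hp3⟩, (hO1.inter hO2).inter hO3,
    ⟨⟨h01, h02⟩, h03⟩, 2 * C1 + 2 * C2, by finiteness, fun h hh f hf => ?_⟩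
  have hfm := hf.continuous
  have hΦc : Continuous (Φ h) := c1.comp (f := fun p => (h, p)) (by fun_prop)
  have hΨc : Continuous (Ψ h) := c2.comp (f := fun p => (h, p)) (by fun_prop)
  have mm : Measurable fun p => ENNReal.ofReal ((f (Φ h p) - f p) ^ 2) :=
    ENNReal.measurable_ofReal.comp (Continuous.measurable (by fun_prop))
  calc ∫⁻ p in U2 ∩ U3, ENNReal.ofReal ((f (Φ h (Ψ h p)) - f p) ^ 2)
      ≤ ∫⁻ p in U2 ∩ U3, (2 * ENNReal.ofReal ((f (Φ h (Ψ h p)) - f (Ψ h p)) ^ 2) +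
          2 * ENNReal.ofReal ((f (Ψ h p) - f p) ^ 2)) :=
        lintegral_mono fun p => sq_add_le_ofReal _ _ _
    _ = 2 * (∫⁻ p in U2 ∩ U3, ENNReal.ofReal ((f (Φ h (Ψ h p)) - f (Ψ h p)) ^ 2)) +
          2 * ∫⁻ p in U2 ∩ U3, ENNReal.ofReal ((f (Ψ h p) - f p) ^ 2) := by
        rw [lintegral_add_left, lintegral_const_mul' _ _ (by finiteness),
          lintegral_const_mul' _ _ (by finiteness)]
        exact (mm.comp hΨc.measurable).const_mul 2
    _ ≤ 2 * (C1 * DG L r f) + 2 * (C2 * DG L r f) := by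
        gcongr
        · calc _ ≤ ∫⁻ p in Ψ h ⁻¹' U1, ENNReal.ofReal ((f (Φ h (Ψ h p)) - f (Ψ h p)) ^ 2) :=
              lintegral_mono_set fun p hp => hOU (Set.mk_mem_prod hh.2 hp.2)
            _ = ∫⁻ p in U1, ENNReal.ofReal ((f (Φ h p) - f p) ^ 2) :=
              (m2 h).setLIntegral_comp_preimage hU1.measurableSet mm
            _ ≤ _ := H1 h hh.1.1 f hf
        · exact (lintegral_mono_set Set.inter_subset_left).trans (H2 h hh.1.2 f hf)
    _ = _ := by ring

/-- signed square root -/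
noncomputable def ssq (w : ℝ) : ℝ := √(max w 0) - √(max (-w) 0)

lemma ssq_mul (w : ℝ) : √|w| * ssq w = w := by
  unfold ssq
  rcases le_total 0 w with h | h
  · rw [abs_of_nonneg h, max_eq_left h, max_eq_right (by linarith)]
    simp [Real.mul_self_sqrt h]
  · rw [abs_of_nonpos h, max_eq_right h, max_eq_left (by linarith)]
    have := Real.mul_self_sqrt (show 0 ≤ -w by linarith)
    simp; linarith

lemma om_neg_left {n : ℕ} (L : Fin n → ℝ) (v x : Fin (2 * n) → ℝ) : om L (-v) x = - om L v x := by
  simp [om]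

lemma om_neg_right {n : ℕ} (L : Fin n → ℝ) (v x : Fin (2 * n) → ℝ) :
    om L v (-x) = - om L v x := by
  rw [← neg_one_smul ℝ x, om_smul_right]; ring

lemma exists_uv {n : ℕ} (hn : 2 ≤ n) (L : Fin n → ℝ) (hL : ∀ j, L j ≠ 0) :
    ∃ u u' : Fin (2 * n) → ℝ, om L u' u - om L u u' ≠ 0 := by
  refine ⟨Pi.single ⟨0, by omega⟩ 1, Pi.single ⟨n, by omega⟩ 1, ?_⟩
  have e1 : om L (Pi.single ⟨n, by omega⟩ 1) (Pi.single ⟨0, by omega⟩ 1) = L ⟨0, by omega⟩ := by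
    unfold om
    rw [Finset.sum_eq_single ⟨n, by omega⟩]
    · simp [Yv]
    · intro b _ hb; simp [Pi.single_apply, hb]
    · simp
  have e2 : om L (Pi.single ⟨0, by omega⟩ 1) (Pi.single ⟨n, by omega⟩ 1) = - L ⟨0, by omega⟩ := by
    unfold om
    rw [Finset.sum_eq_single ⟨0, by omega⟩]
    · have h0 : 0 < n := by omega
      simp [Yv, h0]
    · intro b _ hb; simp [Pi.single_apply, hb]
    · simp
  rw [e1, e2]
  have := hL ⟨0, by omega⟩
  intro h
  apply this
  linarith

lemma good_full {n : ℕ} (hn : 2 ≤ n) (L : Fin n → ℝ) (hL : ∀ j, L j ≠ 0) {r : PtG n → ℝ}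
    (hr0 : ∀ p, 0 < r p) (hrc : ∀ p : PtG n, p.1 ≠ 0 → ContinuousAt r p) :
    Good L r fun h p => (p.1 + h.1, p.2 + (om L h.1 p.1 + h.2)) := by
  obtain ⟨u, u', hκ⟩ := exists_uv hn L hL
  set κ := om L u' u - om L u u' with hκd
  have ca : Continuous fun h : PtG n => √|h.2| • u := by fun_prop
  have cb : Continuous fun h : PtG n => (ssq h.2 / κ) • u' := by unfold ssq; fun_prop
  have a0 : √|(0 : PtG n).2| • u = 0 := by simp
  have b0 : (ssq (0 : PtG n).2 / κ) • u' = 0 := by simp [ssq]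
  have g1 := good_base L hr0 hrc (v := fun h : PtG n => h.1) continuous_fst rfl
  have g2 := good_base L hr0 hrc ca a0
  have g3 := good_base L hr0 hrc cb b0
  have ca2 : Continuous fun h : PtG n => -(√|h.2| • u) := ca.neg
  have cb2 : Continuous fun h : PtG n => -((ssq h.2 / κ) • u') := cb.neg
  have g4 := good_base L hr0 hrc ca2 (by simp)
  have g5 := good_base L hr0 hrc cb2 (by simp [ssq])
  have G := good_comp g5 (good_comp g4 (good_comp g3 (good_comp g2 g1)))
  convert G using 3 with h p
  have hm := ssq_mul h.2
  ext1
  · simp only [Tr]; abel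
  · simp only [Tr, om_add_right, om_neg_left, om_neg_right, om_smul_left, om_smul_right, om_self]
    have : h.2 = √|h.2| * (ssq h.2 / κ) * (om L u' u - om L u u') := by
      rw [← hκd]; field_simp; linarith
    linear_combination this

/-- the double integral of squared differences -/
noncomputable def dbl {n : ℕ} (U V : Set (PtG n)) (f : PtG n → ℝ) : ENNReal :=
  ∫⁻ p in U, ∫⁻ q in V, ENNReal.ofReal ((f p - f q) ^ 2)

lemma meas_sq {n : ℕ} {f : PtG n → ℝ} (hf : Continuous f) :
    Measurable fun q : PtG n × PtG n => ENNReal.ofReal ((f q.1 - f q.2) ^ 2) :=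
  ENNReal.measurable_ofReal.comp (Continuous.measurable (by fun_prop))

lemma dbl_symm {n : ℕ} (U V : Set (PtG n)) {f : PtG n → ℝ} (hf : Continuous f) :
    dbl U V f = dbl V U f := by
  unfold dbl
  rw [lintegral_lintegral_swap (meas_sq hf).aemeasurable]
  refine lintegral_congr fun p => lintegral_congr fun q => ?_
  congr 1; ring

lemma dbl_mono {n : ℕ} {U V U' V' : Set (PtG n)} (hU : U ⊆ U') (hV : V ⊆ V') (f : PtG n → ℝ) :
    dbl U V f ≤ dbl U' V' f := by
  unfold dbl
  exact (lintegral_mono fun p => lintegral_mono_set hV).trans (lintegral_mono_set hU)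

lemma dbl_trans {n : ℕ} (U W S : Set (PtG n)) {f : PtG n → ℝ} (hf : Continuous f) :
    volume S * dbl U W f ≤ 2 * volume W * dbl U S f + 2 * volume U * dbl W S f := by
  have m1 := meas_sq hf
  have mW : Measurable fun p => ∫⁻ q in S, ENNReal.ofReal ((f p - f q) ^ 2) :=
    m1.lintegral_prod_right'
  have h1 : ∀ p q, volume S * ENNReal.ofReal ((f p - f q) ^ 2) ≤
      2 * (∫⁻ s in S, ENNReal.ofReal ((f p - f s) ^ 2)) +
      2 * (∫⁻ s in S, ENNReal.ofReal ((f q - f s) ^ 2)) := fun p q => by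
    calc volume S * ENNReal.ofReal ((f p - f q) ^ 2)
        = ∫⁻ s in S, ENNReal.ofReal ((f p - f q) ^ 2) := by
          rw [lintegral_const, Measure.restrict_apply_univ, mul_comm]
      _ ≤ ∫⁻ s in S, (2 * ENNReal.ofReal ((f p - f s) ^ 2) +
            2 * ENNReal.ofReal ((f q - f s) ^ 2)) := by
          refine lintegral_mono fun s => (sq_add_le_ofReal (f p) (f s) (f q)).trans ?_
          rw [show (f s - f q) ^ 2 = (f q - f s) ^ 2 by ring]
      _ = _ := by
          rw [lintegral_add_left, lintegral_const_mul' _ _ (by finiteness),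
            lintegral_const_mul' _ _ (by finiteness)]
          exact (m1.comp (measurable_prodMk_left (x := p))).const_mul 2
  calc volume S * dbl U W f
      ≤ ∫⁻ p in U, ∫⁻ q in W, volume S * ENNReal.ofReal ((f p - f q) ^ 2) := by
        unfold dbl
        rw [← lintegral_const_mul _ m1.lintegral_prod_right']
        exact lintegral_mono fun p =>
          (lintegral_const_mul _ (m1.comp (measurable_prodMk_left (x := p)))).ge
    _ ≤ ∫⁻ p in U, ∫⁻ q in W, (2 * (∫⁻ s in S, ENNReal.ofReal ((f p - f s) ^ 2)) +
          2 * (∫⁻ s in S, ENNReal.ofReal ((f q - f s) ^ 2))) :=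
        lintegral_mono fun p => lintegral_mono fun q => h1 p q
    _ = ∫⁻ p in U, (2 * volume W * (∫⁻ s in S, ENNReal.ofReal ((f p - f s) ^ 2)) +
          2 * dbl W S f) := by
        refine lintegral_congr fun p => ?_
        rw [lintegral_add_left measurable_const, lintegral_const, Measure.restrict_apply_univ,
          lintegral_const_mul' _ _ (by finiteness)]
        unfold dbl
        ring
    _ = _ := by
        rw [lintegral_add_right _ measurable_const, lintegral_const, Measure.restrict_apply_univ,
          lintegral_const_mul _ mW]
        unfold dbl
        ring

/-- the chaining relation -/
def RelG {n : ℕ} (L : Fin n → ℝ) (r : PtG n → ℝ) (p q : PtG n) : Prop :=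
  ∃ U V : Set (PtG n), IsOpen U ∧ IsOpen V ∧ p ∈ U ∧ q ∈ V ∧ volume U ≠ ⊤ ∧ volume V ≠ ⊤ ∧
    ∃ C : ENNReal, C ≠ ⊤ ∧ ∀ f : PtG n → ℝ, ContDiff ℝ 1 f → dbl U V f ≤ C * DG L r f

lemma RelG.symm {n : ℕ} {L : Fin n → ℝ} {r : PtG n → ℝ} {p q : PtG n} (h : RelG L r p q) :
    RelG L r q p := by
  obtain ⟨U, V, hU, hV, hp, hq, vU, vV, C, hC, H⟩ := h
  exact ⟨V, U, hV, hU, hq, hp, vV, vU, C, hC, fun f hf => by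
    rw [dbl_symm _ _ hf.continuous]; exact H f hf⟩

lemma RelG.trans {n : ℕ} {L : Fin n → ℝ} {r : PtG n → ℝ} {p q s : PtG n} (h : RelG L r p q)
    (h' : RelG L r q s) : RelG L r p s := by
  obtain ⟨U, V, hU, hV, hp, hq, vU, vV, C, hC, H⟩ := h
  obtain ⟨V', W, hV', hW, hq', hs, vV', vW, C', hC', H'⟩ := h'
  set S := V ∩ V'
  have hS0 : volume S ≠ 0 := ((hV.inter hV').measure_pos volume ⟨q, hq, hq'⟩).ne'
  have hSt : volume S ≠ ⊤ := ne_top_of_le_ne_top vV (measure_mono Set.inter_subset_left)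
  refine ⟨U, W, hU, hW, hp, hs, vU, vW,
    (volume S)⁻¹ * (2 * volume W * C + 2 * volume U * C'), ?_, fun f hf => ?_⟩
  · refine ENNReal.mul_ne_top (ENNReal.inv_ne_top.2 hS0) (by finiteness)
  · have h1 := dbl_trans U W S hf.continuous
    have h2 : dbl U S f ≤ C * DG L r f :=
      (dbl_mono le_rfl Set.inter_subset_left f).trans (H f hf)
    have h3 : dbl W S f ≤ C' * DG L r f := by
      rw [dbl_symm _ _ hf.continuous]
      exact (dbl_mono Set.inter_subset_right le_rfl f).trans (H' f hf)
    calc dbl U W f = (volume S)⁻¹ * (volume S * dbl U W f) := by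
          rw [← mul_assoc, ENNReal.inv_mul_cancel hS0 hSt, one_mul]
      _ ≤ (volume S)⁻¹ * (2 * volume W * (C * DG L r f) + 2 * volume U * (C' * DG L r f)) := by
          gcongr
          exact h1.trans (by gcongr)
      _ = _ := by ring

lemma rel_local {n : ℕ} (hn : 2 ≤ n) (L : Fin n → ℝ) (hL : ∀ j, L j ≠ 0) {r : PtG n → ℝ}
    (hr0 : ∀ p, 0 < r p) (hrc : ∀ p : PtG n, p.1 ≠ 0 → ContinuousAt r p) (p0 : PtG n)
    (hp0 : p0.1 ≠ 0) : ∀ᶠ q in nhds p0, RelG L r p0 q := by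
  obtain ⟨-, -, -, H⟩ := good_full hn L hL hr0 hrc
  obtain ⟨U, O, hU, hpU, hO, h0O, C, hC, H⟩ := H p0 hp0
  set O' := O ∩ Metric.ball 0 1
  have hO' : IsOpen O' := hO.inter Metric.isOpen_ball
  have vO' : volume O' ≠ ⊤ :=
    ne_top_of_le_ne_top measure_ball_lt_top.ne (measure_mono Set.inter_subset_right)
  have com := continuous_om L
  have hη : Continuous fun w : PtG n × PtG n =>
      ((w.2.1 - w.1.1, w.2.2 - w.1.2 - om L (w.2.1 - w.1.1) w.1.1) : PtG n) := by
    have : Continuous fun w : PtG n × PtG n => om L (w.2.1 - w.1.1) w.1.1 :=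
      com.comp (f := fun w : PtG n × PtG n => (w.2.1 - w.1.1, w.1.1)) (by fun_prop)
    fun_prop
  have hev : ∀ᶠ w : PtG n × PtG n in nhds (p0, p0),
      ((w.2.1 - w.1.1, w.2.2 - w.1.2 - om L (w.2.1 - w.1.1) w.1.1) : PtG n) ∈ O' := by
    refine hη.continuousAt.eventually_mem (hO'.mem_nhds ?_)
    have : om L (0 : Fin (2 * n) → ℝ) p0.1 = 0 := by simp [om]
    simp only [sub_self, this]
    exact ⟨h0O, Metric.mem_ball_self one_pos⟩
  obtain ⟨U1, U2, hU1, hp1, hU2, hp2, hUU⟩ := mem_nhds_prod_iff'.1 hev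
  set W := U ∩ U1 ∩ U2 ∩ Metric.ball p0 1
  have hW : IsOpen W := ((hU.inter hU1).inter hU2).inter Metric.isOpen_ball
  have hpW : p0 ∈ W := ⟨⟨⟨hpU, hp1⟩, hp2⟩, Metric.mem_ball_self one_pos⟩
  have vW : volume W ≠ ⊤ :=
    ne_top_of_le_ne_top measure_ball_lt_top.ne (measure_mono Set.inter_subset_right)
  filter_upwards [hW.mem_nhds hpW] with q hq
  refine ⟨W, W, hW, hW, hpW, hq, vW, vW, C * volume O', by finiteness, fun f hf => ?_⟩
  have hfc := hf.continuous
  have hΦ : Continuous fun w : PtG n × PtG n =>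
      ((w.1.1 + w.2.1, w.1.2 + (om L w.2.1 w.1.1 + w.2.2)) : PtG n) := by
    have : Continuous fun w : PtG n × PtG n => om L w.2.1 w.1.1 :=
      com.comp (f := fun w : PtG n × PtG n => (w.2.1, w.1.1)) (by fun_prop)
    fun_prop
  calc dbl W W f ≤ ∫⁻ p in W, ∫⁻ h in O',
        ENNReal.ofReal ((f (p.1 + h.1, p.2 + (om L h.1 p.1 + h.2)) - f p) ^ 2) := by
        refine setLIntegral_mono' hW.measurableSet fun p hp => ?_
        have mp : MeasurePreserving fun h : PtG n =>
            ((p.1 + h.1, p.2 + (om L h.1 p.1 + h.2)) : PtG n) := by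
          have := mp_shear p.1 (g := fun x => p.2 + om L x p.1)
            (continuous_const.add (com.comp (f := fun x => (x, p.1)) (by fun_prop)))
          convert this using 3 with h
          · rw [add_comm]
          · ring
        have hm : Measurable fun q => ENNReal.ofReal ((f q - f p) ^ 2) :=
          ENNReal.measurable_ofReal.comp (Continuous.measurable (by fun_prop))
        calc ∫⁻ q in W, ENNReal.ofReal ((f p - f q) ^ 2)
            = ∫⁻ q in W, ENNReal.ofReal ((f q - f p) ^ 2) :=
              lintegral_congr fun q => by congr 1; ring
          _ = _ := (mp.setLIntegral_comp_preimage hW.measurableSet hm).symm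
          _ ≤ _ := by
              refine lintegral_mono_set fun h hh => ?_
              have := hUU (Set.mk_mem_prod hp.1.1.2 hh.1.2)
              simp only [Set.mem_setOf_eq] at this
              convert this using 1
              ext1
              · simp
              · simp
    _ = ∫⁻ h in O', ∫⁻ p in W,
        ENNReal.ofReal ((f (p.1 + h.1, p.2 + (om L h.1 p.1 + h.2)) - f p) ^ 2) := by
        refine lintegral_lintegral_swap (Measurable.aemeasurable ?_)
        refine ENNReal.measurable_ofReal.comp (Continuous.measurable ?_)
        exact ((hfc.comp hΦ).sub (hfc.comp continuous_fst)).pow 2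
    _ ≤ ∫⁻ h in O', C * DG L r f := by
        refine setLIntegral_mono' hO'.measurableSet fun h hh => ?_
        exact (lintegral_mono_set fun p hp => hp.1.1.1).trans (H h hh.1 f hf)
    _ = _ := by
        rw [lintegral_const, Measure.restrict_apply_univ]; ring

lemma rel_all {n : ℕ} (hn : 2 ≤ n) (L : Fin n → ℝ) (hL : ∀ j, L j ≠ 0) {r : PtG n → ℝ}
    (hr0 : ∀ p, 0 < r p) (hrc : ∀ p : PtG n, p.1 ≠ 0 → ContinuousAt r p) {p q : PtG n}
    (hp : p.1 ≠ 0) (hq : q.1 ≠ 0) : RelG L r p q := by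
  have hconn : IsPreconnected {p : PtG n | p.1 ≠ 0} := by
    have h1 : IsConnected ({0}ᶜ : Set (Fin (2 * n) → ℝ)) := by
      refine isConnected_compl_singleton_of_one_lt_rank ?_ 0
      rw [rank_fun']
      simp only [Fintype.card_fin]
      exact_mod_cast (by omega : 1 < 2 * n)
    have h2 := h1.isPreconnected.prod (isPreconnected_univ (α := ℝ))
    convert h2 using 1
    ext p; simp
  refine hconn.induction₂ (RelG L r) (fun x hx => ?_) (fun x y z _ _ _ h h' => h.trans h')
    (fun x y _ _ h => h.symm) hp hq
  exact nhdsWithin_le_nhds (rel_local hn L hL hr0 hrc x hx)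

lemma local_poincare {n : ℕ} (hn : 2 ≤ n) (L : Fin n → ℝ) (hL : ∀ j, L j ≠ 0) {r : PtG n → ℝ}
    (hr0 : ∀ p, 0 < r p) (hrc : ∀ p : PtG n, p.1 ≠ 0 → ContinuousAt r p) {K : Set (PtG n)}
    (hK : IsCompact K) (hKne : ∀ p ∈ K, p.1 ≠ 0) :
    ∃ C : ENNReal, C ≠ ⊤ ∧ ∀ f : PtG n → ℝ, ContDiff ℝ 1 f →
      ∃ c : ℝ, ∫⁻ p in K, ENNReal.ofReal ((f p - c) ^ 2) ≤ C * DG L r f := by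
  obtain ⟨p1, hp1⟩ : ∃ p1 : PtG n, p1.1 ≠ 0 := by
    refine ⟨(fun _ => 1, 0), fun h => ?_⟩
    have := congrFun h ⟨0, by omega⟩
    simp at this
  have key : ∃ V : Set (PtG n), IsOpen V ∧ p1 ∈ V ∧ volume V ≠ ⊤ ∧ ∃ C : ENNReal, C ≠ ⊤ ∧
      ∀ f : PtG n → ℝ, ContDiff ℝ 1 f → dbl V K f ≤ C * DG L r f := by
    refine hK.induction_on (p := fun K => ∃ V : Set (PtG n), IsOpen V ∧ p1 ∈ V ∧ volume V ≠ ⊤ ∧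
      ∃ C : ENNReal, C ≠ ⊤ ∧
      ∀ f : PtG n → ℝ, ContDiff ℝ 1 f → dbl V K f ≤ C * DG L r f) ?_ ?_ ?_ ?_
    · exact ⟨Metric.ball p1 1, Metric.isOpen_ball, Metric.mem_ball_self one_pos,
        measure_ball_lt_top.ne, 0, by simp, fun f _ => by simp [dbl]⟩
    · rintro s t hst ⟨V, hV, hp, vV, C, hC, H⟩
      exact ⟨V, hV, hp, vV, C, hC, fun f hf => (dbl_mono le_rfl hst f).trans (H f hf)⟩
    · rintro s t ⟨V, hV, hp, vV, C, hC, H⟩ ⟨V', hV', hp', vV', C', hC', H'⟩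
      refine ⟨V ∩ V', hV.inter hV', ⟨hp, hp'⟩,
        ne_top_of_le_ne_top vV (measure_mono Set.inter_subset_left), C + C', by finiteness,
        fun f hf => ?_⟩
      calc dbl (V ∩ V') (s ∪ t) f ≤ dbl (V ∩ V') s f + dbl (V ∩ V') t f := by
            unfold dbl
            rw [← lintegral_add_left (meas_sq hf.continuous).lintegral_prod_right']
            exact lintegral_mono fun p => lintegral_union_le _ _ _
        _ ≤ C * DG L r f + C' * DG L r f := by
            gcongr
            · exact (dbl_mono Set.inter_subset_left le_rfl f).trans (H f hf)
            · exact (dbl_mono Set.inter_subset_right le_rfl f).trans (H' f hf)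
        _ = _ := by ring
    · intro p hp
      obtain ⟨U, V, hU, hV, h1, h2, vU, vV, C, hC, H⟩ := rel_all hn L hL hr0 hrc hp1 (hKne p hp)
      exact ⟨V, mem_nhdsWithin_of_mem_nhds (hV.mem_nhds h2), U, hU, h1, vU, C, hC, H⟩
  obtain ⟨V, hV, hp, vV, C, hC, H⟩ := key
  have vV0 : volume V ≠ 0 := (hV.measure_pos volume ⟨p1, hp⟩).ne'
  refine ⟨(volume V)⁻¹ * C, ENNReal.mul_ne_top (ENNReal.inv_ne_top.2 vV0) hC, fun f hf => ?_⟩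
  obtain ⟨q, hq, hle⟩ := exists_le_setLAverage (μ := volume) vV0 vV
    (f := fun p => ∫⁻ q in K, ENNReal.ofReal ((f p - f q) ^ 2))
    (meas_sq hf.continuous).lintegral_prod_right'.aemeasurable
  refine ⟨f q, ?_⟩
  calc ∫⁻ p in K, ENNReal.ofReal ((f p - f q) ^ 2)
      = ∫⁻ p in K, ENNReal.ofReal ((f q - f p) ^ 2) :=
        lintegral_congr fun p => by congr 1; ring
    _ ≤ _ := hle
    _ = (volume V)⁻¹ * dbl V K f := by
        rw [setLAverage_eq, ENNReal.div_eq_inv_mul]; rfl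
    _ ≤ (volume V)⁻¹ * (C * DG L r f) := by gcongr; exact H f hf
    _ = _ := by ring

lemma integral_gibbsP {n : ℕ} {U : PtG n → ℝ} (hZ : Integrable fun p => Real.exp (-(U p)))
    (hZpos : 0 < ∫ p, Real.exp (-(U p))) (g : PtG n → ℝ) :
    ∫ p, g p ∂(gibbsP U) = (∫ p, Real.exp (-(U p)))⁻¹ * ∫ p, g p * Real.exp (-(U p)) := by
  unfold gibbsP
  rw [integral_smul_measure, integral_withDensity_eq_integral_toReal_smul₀
    hZ.aemeasurable.ennreal_ofReal (Eventually.of_forall fun _ => ENNReal.ofReal_lt_top)]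
  rw [ENNReal.toReal_inv, ENNReal.toReal_ofReal hZpos.le, smul_eq_mul]
  congr 1
  refine integral_congr_ae (Eventually.of_forall fun p => ?_)
  simp only [smul_eq_mul]
  rw [ENNReal.toReal_ofReal (Real.exp_pos _).le, mul_comm]

lemma rG_poincare {n : ℕ} (hn : 2 ≤ n) {L : Fin n → ℝ} (hL : ∀ j, L j ≠ 0) {β : ℝ} (hβ : 0 < β)
    {V V' : ℝ → ℝ} (hV' : ∀ s, HasDerivAt V (V' s) s) (hVc : Continuous V') (hVmono : Monotone V)
    (hgrow : Tendsto (fun s => V' s / s ^ 2) atTop atTop)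
    (hr : Integrable (rG L β V)) :
    ∃ C > (0 : ℝ), ∀ f : PtG n → ℝ, ContDiff ℝ 1 f → HasCompactSupport f → ∃ c : ℝ,
      ∫ p, (f p - c) ^ 2 * rG L β V p ≤ C * ∫ p, gradSqG L f p * rG L β V p := by
  obtain ⟨K, C, hK, hKne, hC, H⟩ := ubound hn hL hβ hV' hVc hVmono hgrow hr
  obtain ⟨l, l', hl, hl', hll⟩ := exists_consts hn L hL
  have hV1 : ContDiff ℝ 1 V := contDiff_one_iff_deriv.2
    ⟨fun s => (hV' s).differentiableAt, by rwa [show deriv V = V' from funext fun s => (hV' s).deriv]⟩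
  have hr0 : ∀ p, 0 < rG L β V p := fun p => Real.exp_pos _
  have hrc : ∀ p : PtG n, p.1 ≠ 0 → ContinuousAt (rG L β V) p := fun p hp =>
    continuousAt_rG hl (fun x => (hll x).2.2) β hV1 p hp
  obtain ⟨C2, hC2, H2⟩ := local_poincare hn L hL hr0 hrc hK hKne
  obtain ⟨M, hM⟩ := hK.exists_bound_of_continuousOn
    (f := rG L β V) fun p hp => (hrc p (hKne p hp)).continuousWithinAt
  have hM' : ∀ p ∈ K, rG L β V p ≤ max M 0 := fun p hp =>
    (le_abs_self _).trans ((hM p hp).trans (le_max_left _ _))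
  refine ⟨2 + C * (max M 0 * C2.toReal), by positivity, fun f hf hs => ?_⟩
  obtain ⟨c, hc⟩ := H2 f hf
  refine ⟨c, ?_⟩
  have hfc := hf.continuous
  have hgn : ∀ p, 0 ≤ gradSqG L f p := fun p => Finset.sum_nonneg fun _ _ => sq_nonneg _
  have hDG : DG L (rG L β V) f = ENNReal.ofReal (∫ p, gradSqG L f p * rG L β V p) := by
    rw [ofReal_integral_eq_lintegral_ofReal
      (int_mul_r hr (continuous_gradSqG L hf) (hcs_gradSqG L hs))
      (Eventually.of_forall fun p => mul_nonneg (hgn p) (hr0 p).le)]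
    unfold DG
    exact lintegral_congr fun p => (ENNReal.ofReal_mul (hgn p)).symm
  have hI0 : 0 ≤ ∫ p, gradSqG L f p * rG L β V p :=
    integral_nonneg fun p => mul_nonneg (hgn p) (hr0 p).le
  have hIntg : IntegrableOn (fun p => (f p - c) ^ 2) K :=
    ContinuousOn.integrableOn_compact hK (by fun_prop)
  have h1 : ∫ p in K, (f p - c) ^ 2 ≤ C2.toReal * ∫ p, gradSqG L f p * rG L β V p := by
    rw [integral_eq_lintegral_of_nonneg_ae (Eventually.of_forall fun p => sq_nonneg _)
      hIntg.aestronglyMeasurable]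
    refine (ENNReal.toReal_mono ?_ hc).trans ?_
    · rw [hDG]; finiteness
    · rw [ENNReal.toReal_mul, hDG, ENNReal.toReal_ofReal hI0]
  have h2 : ∫ p in K, (f p - c) ^ 2 * rG L β V p ≤ max M 0 * ∫ p in K, (f p - c) ^ 2 := by
    rw [← integral_const_mul]
    refine setIntegral_mono_on (int_sq_r hr hfc hs c).integrableOn (hIntg.const_mul _)
      hK.measurableSet fun p hp => ?_
    rw [mul_comm]
    exact mul_le_mul_of_nonneg_right (hM' p hp) (sq_nonneg _)
  have h3 := H f hf hs c
  have h4 : ∫ p in K, (f p - c) ^ 2 * rG L β V p ≤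
      max M 0 * (C2.toReal * ∫ p, gradSqG L f p * rG L β V p) :=
    h2.trans (mul_le_mul_of_nonneg_left h1 (le_max_right _ _))
  have h5 := mul_le_mul_of_nonneg_left h4 hC
  linarith

theorem generalised_heisenberg_log_taming_poincare
    (n : ℕ) (hn : 2 ≤ n) (L : Fin n → ℝ) (hL : ∀ j, L j ≠ 0)
    (β : ℝ) (hβ : 0 < β)
    (V V' V'' : ℝ → ℝ)
    (hV' : ∀ s : ℝ, HasDerivAt V (V' s) s)
    (hV'' : ∀ s : ℝ, HasDerivAt V' (V'' s) s)
    (hVmono : Monotone V)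
    (hgrow : Tendsto (fun s => V' s / s ^ 2) atTop atTop)
    (hcoer : ∃ R : ℝ, ∀ s : ℝ, R ≤ |s| → 0 ≤ (1 / 4) * (V' s) ^ 2 - (1 / 2) * V'' s)
    (hZint : Integrable (fun p : PtG n => Real.exp (-(Ulog L β V p))))
    (hZpos : 0 < ∫ p : PtG n, Real.exp (-(Ulog L β V p))) :
    ∃ c > (0 : ℝ), ∀ f : PtG n → ℝ, ContDiff ℝ (⊤ : ℕ∞) f → HasCompactSupport f →
      ∫ p, (f p - ∫ q, f q ∂(gibbsP (Ulog L β V))) ^ 2 ∂(gibbsP (Ulog L β V))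
        ≤ c * ∫ p, gradSqG L f p ∂(gibbsP (Ulog L β V)) := by
  have hrU : (fun p : PtG n => Real.exp (-(Ulog L β V p))) = rG L β V :=
    funext fun p => by rw [Ulog_eq]; rfl
  have hVc : Continuous V' := continuous_iff_continuousAt.2 fun s => (hV'' s).continuousAt
  have hr : Integrable (rG L β V) := hrU ▸ hZint
  obtain ⟨C, hC, H⟩ := rG_poincare hn hL hβ hV' hVc hVmono hgrow hr
  refine ⟨C, hC, fun f hf hs => ?_⟩
  have hf1 : ContDiff ℝ 1 f := hf.of_le (by exact_mod_cast le_top)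
  have hfc := hf1.continuous
  obtain ⟨c, hc⟩ := H f hf1 hs
  rw [integral_gibbsP hZint hZpos (fun p => (f p - ∫ q, f q ∂(gibbsP (Ulog L β V))) ^ 2),
    integral_gibbsP hZint hZpos f, integral_gibbsP hZint hZpos (gradSqG L f)]
  have hrU' : ∀ p, Real.exp (-(Ulog L β V p)) = rG L β V p := fun p => congrFun hrU p
  simp only [hrU'] at hZpos ⊢
  set Z := ∫ p, rG L β V p with hZ
  set I := ∫ p, f p * rG L β V p with hI
  set m := Z⁻¹ * I with hm
  have hIm : I = Z * m := by rw [hm]; field_simp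
  have i1 : Integrable fun p => f p * rG L β V p := int_mul_r hr hfc hs
  have i2 := int_sq_r hr hfc hs m
  have e : ∫ p, (f p - c) ^ 2 * rG L β V p =
      (∫ p, (f p - m) ^ 2 * rG L β V p) + (m - c) ^ 2 * Z := by
    have e1 : ∀ p, (f p - c) ^ 2 * rG L β V p = (f p - m) ^ 2 * rG L β V p +
        (2 * (m - c) * (f p * rG L β V p) +
          ((m - c) ^ 2 - 2 * (m - c) * m) * rG L β V p) := fun p => by ring
    simp only [e1]
    have i3 : Integrable fun p => 2 * (m - c) * (f p * rG L β V p) +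
        ((m - c) ^ 2 - 2 * (m - c) * m) * rG L β V p := (i1.const_mul _).add (hr.const_mul _)
    rw [integral_add i2 i3,
      integral_add (i1.const_mul _) (hr.const_mul _), integral_const_mul, integral_const_mul,
      ← hI, ← hZ, hIm]
    ring
  have h6 : ∫ p, (f p - m) ^ 2 * rG L β V p ≤ C * ∫ p, gradSqG L f p * rG L β V p := by
    have : 0 ≤ (m - c) ^ 2 * Z := by positivity
    linarith
  calc _ ≤ Z⁻¹ * (C * ∫ p, gradSqG L f p * rG L β V p) :=
        mul_le_mul_of_nonneg_left h6 (inv_nonneg.2 hZpos.le)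
    _ = _ := by ring
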